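/- arXiv:1812.09981 — 3 statements merged into one kernel-verified Lean document; each statement's English description precedes it below -/
import Mathlib

section
/- Let A be an Artinian Bernstein algebra over a field K of characteristic ≠ 2, 3, with Peirce decomposition A = Ke ⊕ U ⊕ V relative to an idempotent e of weight 1, and barideal N = U ⊕ V. The following are equivalent: (i) the ideal N is nilpotent (Nⁿ = 0 for some n); (ii) the associative subalgebra of End_K(N) generated by the left-multiplication operators L_v : N → N (x ↦ vx), for v ∈ V, is nilpotent; (iii) the only K-subspace I of A satisfying VI = I is I = 0. -/
/-- The product of two subspaces of a (possibly non-associative, non-unital) algebra: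
the linear span of all products `x * y` with `x ∈ M`, `y ∈ N`. -/
def subMul {K A : Type*} [Field K] [NonUnitalNonAssocRing A] [Module K A]
    [SMulCommClass K A A] [IsScalarTower K A A]
    (M N : Submodule K A) : Submodule K A :=
  Submodule.map₂ (LinearMap.mul K A) M N

/-- The powers `Sⁱ` of a subspace `S`, defined (for `i ≥ 1`) by `S¹ = S` and
`Sⁱ = Σ_{r+s=i, r,s ≥ 1} Sʳ Sˢ`.  (We set `S⁰ = S`, an irrelevant junk value.) -/
def algPow {K A : Type*} [Field K] [NonUnitalNonAssocRing A] [Module K A]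
    [SMulCommClass K A A] [IsScalarTower K A A]
    (S : Submodule K A) : ℕ → Submodule K A
  | 0 => S
  | 1 => S
  | n + 2 => ⨆ r : Fin (n + 1), subMul (algPow S (r + 1)) (algPow S (n + 1 - r))
  decreasing_by
  · omega
  · omega

/-- The Peirce component `U = {u : A | e * u = (1/2) • u}` relative to an idempotent `e`. -/
def peirceU (K : Type*) {A : Type*} [Field K] [NonUnitalNonAssocCommRing A] [Module K A]
    [SMulCommClass K A A] [IsScalarTower K A A] (e : A) : Submodule K A where
  carrier := {u : A | e * u = (2 : K)⁻¹ • u}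
  add_mem' := by
    intro a b ha hb
    simp only [Set.mem_setOf_eq] at *
    rw [mul_add, ha, hb, smul_add]
  zero_mem' := by simp
  smul_mem' := by
    intro c x hx
    simp only [Set.mem_setOf_eq] at *
    rw [mul_smul_comm, hx, smul_comm]

/-- The Peirce component `V = {v : A | e * v = 0}` relative to an idempotent `e`. -/
def peirceV (K : Type*) {A : Type*} [Field K] [NonUnitalNonAssocCommRing A] [Module K A]
    [SMulCommClass K A A] [IsScalarTower K A A] (e : A) : Submodule K A where
  carrier := {v : A | e * v = 0}
  add_mem' := by
    intro a b ha hb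
    simp only [Set.mem_setOf_eq] at *
    rw [mul_add, ha, hb, add_zero]
  zero_mem' := by simp
  smul_mem' := by
    intro c x hx
    simp only [Set.mem_setOf_eq] at *
    rw [mul_smul_comm, hx, smul_zero]

section Words

variable {K U V ι : Type*} [Field K] [AddCommGroup U] [Module K U] [AddCommGroup V] [Module K V]

/-- The structure carried by `U ⊕ V` in a Bernstein–Jordan algebra: a symmetric form
`b : U × U → V` and an action `m` of `V` on `U` by anticommuting operators. -/
structure IsBernsteinPair (b : U →ₗ[K] U →ₗ[K] V) (m : V →ₗ[K] Module.End K U) : Prop where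
  comm : ∀ x y, b x y = b y x
  anti : ∀ v w, m v * m w = -(m w * m v)
  skew : ∀ x v y, b x (m v y) = -b y (m v x)
  jacobi : ∀ x y z, m (b x y) z + m (b y z) x + m (b z x) y = 0

/-- `IsWord b m u W q D s f` says that `f` is a product of operators `m v` with `v ∈ W` and
operators `m (b (u i) (g (u k)))` with `g` again such a product; altogether there are `D` letters,
`q` of which are of the second kind, and `s i` counts how often `u i` is used by the latter. -/
inductive IsWord [DecidableEq ι] (b : U →ₗ[K] U →ₗ[K] V) (m : V →ₗ[K] Module.End K U)
    (u : ι → U) (W : Submodule K V) : ℕ → ℕ → (ι → ℕ) → Module.End K U → Prop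
  | one : IsWord b m u W 0 0 0 1
  | letter {q D : ℕ} {s : ι → ℕ} {f : Module.End K U} (v : V) : v ∈ W →
      IsWord b m u W q D s f → IsWord b m u W q (D + 1) s (m v * f)
  | comp {q D q' D' : ℕ} {s s' : ι → ℕ} {g f : Module.End K U} (i k : ι) :
      IsWord b m u W q D s g → IsWord b m u W q' D' s' f →
      IsWord b m u W (q + q' + 1) (D + D' + 1) (Pi.single i 1 + Pi.single k 1 + s + s')
        (m (b (u i) (g (u k))) * f)

/-- The span of the vectors `f (u j)`, where `f` is a word with `D` letters, subject to a
condition on the number of composite letters, the content and `j`. -/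
def wordSpan [DecidableEq ι] (b : U →ₗ[K] U →ₗ[K] V) (m : V →ₗ[K] Module.End K U)
    (u : ι → U) (W : Submodule K V) (D : ℕ) (Q : ℕ → (ι → ℕ) → ι → Prop) : Submodule K U :=
  Submodule.span K {x | ∃ q s j f, Q q s j ∧ IsWord b m u W q D s f ∧ f (u j) = x}

variable [DecidableEq ι] {b : U →ₗ[K] U →ₗ[K] V} {m : V →ₗ[K] Module.End K U}
  {u : ι → U} {W : Submodule K V}

theorem IsWord.mem_wordSpan {q D : ℕ} {s : ι → ℕ} {f : Module.End K U}
    (hf : IsWord b m u W q D s f) {Q : ℕ → (ι → ℕ) → ι → Prop} {j : ι} (hQ : Q q s j) :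
    f (u j) ∈ wordSpan b m u W D Q :=
  Submodule.subset_span ⟨q, s, j, f, hQ, hf, rfl⟩

theorem wordSpan_le {D : ℕ} {Q : ℕ → (ι → ℕ) → ι → Prop} {X : Submodule K U}
    (h : ∀ q s j f, Q q s j → IsWord b m u W q D s f → f (u j) ∈ X) :
    wordSpan b m u W D Q ≤ X := by
  refine Submodule.span_le.2 ?_
  rintro _ ⟨q, s, j, f, hQ, hf, rfl⟩
  exact h q s j f hQ hf

theorem IsWord.mul {q D q' D' : ℕ} {s s' : ι → ℕ} {f g : Module.End K U}
    (hf : IsWord b m u W q D s f) (hg : IsWord b m u W q' D' s' g) :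
    IsWord b m u W (q + q') (D + D') (s + s') (f * g) := by
  induction hf with
  | one => simpa using hg
  | letter v hv _ ih =>
    have := IsWord.letter v hv ih
    rwa [← mul_assoc, Nat.add_right_comm] at this
  | comp i k h1 _ _ ih =>
    have := IsWord.comp i k h1 ih
    rw [← mul_assoc] at this
    convert this using 1
    · ring
    · ring
    · simp only [add_assoc]

theorem IsWord.single {q D : ℕ} {s : ι → ℕ} {g : Module.End K U}
    (hg : IsWord b m u W q D s g) (i k : ι) :
    IsWord b m u W (q + 1) (D + 1) (Pi.single i 1 + Pi.single k 1 + s)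
      (m (b (u i) (g (u k)))) := by
  simpa using IsWord.comp i k hg IsWord.one

theorem IsWord.apply_mem_wordSpan {q₀ D₀ D : ℕ} {s₀ : ι → ℕ} {f : Module.End K U}
    (hf : IsWord b m u W q₀ D₀ s₀ f) {Q Q' : ℕ → (ι → ℕ) → ι → Prop}
    (hQ : ∀ q s j, Q q s j → Q' (q₀ + q) (s₀ + s) j) {x : U} (hx : x ∈ wordSpan b m u W D Q) :
    f x ∈ wordSpan b m u W (D₀ + D) Q' := by
  have : wordSpan b m u W D Q ≤ (wordSpan b m u W (D₀ + D) Q').comap f :=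
    wordSpan_le fun q s j g h hg ↦ (hf.mul hg).mem_wordSpan (hQ q s j h)
  exact this hx

theorem letter_apply_mem_wordSpan {D : ℕ} {Q : ℕ → (ι → ℕ) → ι → Prop} {v : V} (hv : v ∈ W)
    {x : U} (hx : x ∈ wordSpan b m u W D Q) : m v x ∈ wordSpan b m u W (D + 1) Q := by
  have : wordSpan b m u W D Q ≤ (wordSpan b m u W (D + 1) Q).comap (m v) :=
    wordSpan_le fun q s j g h hg ↦ (IsWord.letter v hv hg).mem_wordSpan h
  exact this hx

theorem IsWord.exists_comm (hbm : IsBernsteinPair b m) {q D : ℕ} {s : ι → ℕ}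
    {f : Module.End K U} (hf : IsWord b m u W q D s f) :
    ∃ ε : K, ∀ v, m v * f = ε • (f * m v) := by
  induction hf with
  | one => exact ⟨1, by simp⟩
  | letter w _ _ ih =>
    obtain ⟨ε, h⟩ := ih
    refine ⟨-ε, fun v ↦ ?_⟩
    rw [← mul_assoc, hbm.anti v w, neg_mul, mul_assoc, h v, mul_smul_comm, neg_smul, mul_assoc]
  | comp i k _ _ _ ih =>
    obtain ⟨ε, h⟩ := ih
    refine ⟨-ε, fun v ↦ ?_⟩
    rw [← mul_assoc, hbm.anti v, neg_mul, mul_assoc, h v, mul_smul_comm, neg_smul, mul_assoc]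

theorem IsWord.exists_adj (hbm : IsBernsteinPair b m) {q D : ℕ} {s : ι → ℕ}
    {f : Module.End K U} (hf : IsWord b m u W q D s f) :
    ∃ ε : K, ∀ x y, b x (f y) = ε • b y (f x) := by
  have key : ∀ (v : V) (f : Module.End K U) (ε δ : K), (∀ v, m v * f = δ • (f * m v)) →
      (∀ x y, b x (f y) = ε • b y (f x)) →
      ∀ x y, b x ((m v * f) y) = (-(δ * ε)) • b y ((m v * f) x) := by
    intro v f ε δ h1 h2 x y
    rw [h1, LinearMap.smul_apply, map_smul, Module.End.mul_apply, h2, hbm.comm, hbm.skew,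
      smul_neg, smul_neg, smul_smul, neg_smul, ← h1]
    rfl
  induction hf with
  | one => exact ⟨1, fun x y ↦ by simpa using hbm.comm x y⟩
  | letter v _ hf ih =>
    obtain ⟨ε, h⟩ := ih
    obtain ⟨δ, h'⟩ := hf.exists_comm hbm
    exact ⟨_, key v _ ε δ h' h⟩
  | comp i k _ hf _ ih =>
    obtain ⟨ε, h⟩ := ih
    obtain ⟨δ, h'⟩ := hf.exists_comm hbm
    exact ⟨_, key _ _ ε δ h' h⟩

theorem IsWord.sum_content [Fintype ι] {q D : ℕ} {s : ι → ℕ} {f : Module.End K U}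
    (hf : IsWord b m u W q D s f) : ∑ i, s i = 2 * q := by
  induction hf with
  | one => simp
  | letter _ _ _ ih => exact ih
  | comp i k _ _ ih ih' =>
    simp only [Pi.add_apply, Finset.sum_add_distrib, ih, ih', Pi.single_apply,
      Finset.mem_univ, if_true, Finset.sum_ite_eq']
    ring

/-- Moving an operator `m v` through a word. -/
theorem IsWord.apply_apply_mem (hbm : IsBernsteinPair b m) {q D : ℕ} {s : ι → ℕ}
    {f : Module.End K U} (hf : IsWord b m u W q D s f) {v : V} {x : U} {X : Submodule K U}
    (h : f (m v x) ∈ X) : m v (f x) ∈ X := by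
  obtain ⟨ε, hε⟩ := hf.exists_comm hbm
  rw [← Module.End.mul_apply, hε]
  exact X.smul_mem ε h

theorem IsWord.exchange_left (hbm : IsBernsteinPair b m) (hW : ∀ i j, b (u i) (u j) ∈ W)
    {q D : ℕ} {s : ι → ℕ} {g : Module.End K U} (hg : IsWord b m u W q D s g) (i k j : ι) {c : ℕ}
    (hc : c ≤ (Pi.single k 1 + s : ι → ℕ) i) :
    m (b (u i) (g (u k))) (u j) ∈ wordSpan b m u W (D + 1)
      fun q' s' l ↦ q' < q + 1 ∨ q' = q + 1 ∧ c ≤ s' i ∧ l = i := by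
  have hj := hbm.jacobi (u i) (g (u k)) (u j)
  rw [add_assoc, add_eq_zero_iff_eq_neg, hbm.comm (g (u k)) (u j)] at hj
  rw [hj]
  refine Submodule.neg_mem _ (Submodule.add_mem _ ?_ ?_)
  · refine (hg.single j k).mem_wordSpan (Or.inr ⟨rfl, ?_, rfl⟩)
    simp only [Pi.add_apply] at hc ⊢
    omega
  · exact (IsWord.letter _ (hW j i) hg).mem_wordSpan (Or.inl (Nat.lt_succ_self q))

theorem IsWord.exchange_right (hbm : IsBernsteinPair b m) (hW : ∀ i j, b (u i) (u j) ∈ W)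
    {q D : ℕ} {s : ι → ℕ} {g : Module.End K U} (hg : IsWord b m u W q D s g) (i k j : ι) {c : ℕ}
    (hc : c ≤ (Pi.single k 1 + s : ι → ℕ) i) :
    m (b (u k) (g (u i))) (u j) ∈ wordSpan b m u W (D + 1)
      fun q' s' l ↦ q' < q + 1 ∨ q' = q + 1 ∧ c ≤ s' i ∧ l = i := by
  obtain ⟨ε, hε⟩ := hg.exists_adj hbm
  rw [hε, map_smul]
  exact Submodule.smul_mem _ _ (hg.exchange_left hbm hW i k j hc)

/-- Any basis vector occurring in a word can be brought to its end, modulo words with fewer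
composite letters. -/
theorem IsWord.exchange (hbm : IsBernsteinPair b m) (hW : ∀ i j, b (u i) (u j) ∈ W)
    {q D : ℕ} {s : ι → ℕ} {f : Module.End K U} (hf : IsWord b m u W q D s f) (i : ι) :
    ∀ (j : ι) (c : ℕ), c + 1 ≤ s i → f (u j) ∈ wordSpan b m u W D
      fun q' s' l ↦ q' < q ∨ q' = q ∧ c ≤ s' i ∧ l = i := by
  induction hf with
  | one => intro j c hc; simp at hc
  | letter v hv hf ih =>
    intro j c hc
    exact letter_apply_mem_wordSpan hv (ih j c hc)
  | @comp q D q' D' s s' g f a k hg hf ihg ihf =>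
    intro j c hc
    simp only [Pi.add_apply] at hc
    by_cases h1 : 1 ≤ s' i
    · have := (hg.single a k).apply_mem_wordSpan
        (Q' := fun q'' s'' l ↦ q'' < q + q' + 1 ∨ q'' = q + q' + 1 ∧ c ≤ s'' i ∧ l = i) ?_
        (ihf j (s' i - 1) (by omega))
      · rwa [Nat.add_right_comm] at this
      · rintro q'' s'' l (h | ⟨rfl, h, rfl⟩)
        · exact Or.inl (by omega)
        · refine Or.inr ⟨by omega, ?_, rfl⟩
          simp only [Pi.add_apply]
          omega
    · refine hf.apply_apply_mem hbm ?_
      suffices h : m (b (u a) (g (u k))) (u j) ∈ wordSpan b m u W (D + 1)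
          fun q' s' l ↦ q' < q + 1 ∨ q' = q + 1 ∧ c ≤ s' i ∧ l = i by
        have := hf.apply_mem_wordSpan
          (Q' := fun q'' s'' l ↦ q'' < q + q' + 1 ∨ q'' = q + q' + 1 ∧ c ≤ s'' i ∧ l = i) ?_ h
        · rwa [← add_assoc, add_comm D'] at this
        · rintro q'' s'' l (h | ⟨rfl, h, rfl⟩)
          · exact Or.inl (by omega)
          · refine Or.inr ⟨by omega, ?_, rfl⟩
            simp only [Pi.add_apply]
            omega
      by_cases ha : a = i
      · subst ha
        refine hg.exchange_left hbm hW a k j ?_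
        simp only [Pi.add_apply, Pi.single_eq_same] at hc ⊢
        omega
      by_cases hk : k = i
      · subst hk
        refine hg.exchange_right hbm hW k a j ?_
        simp only [Pi.add_apply, Pi.single_eq_same] at hc ⊢
        omega
      rw [Pi.single_eq_of_ne (Ne.symm ha), Pi.single_eq_of_ne (Ne.symm hk)] at hc
      have hle : wordSpan b m u W D (fun q' s' l ↦ q' < q ∨ q' = q ∧ s i - 1 ≤ s' i ∧ l = i) ≤
          (wordSpan b m u W (D + 1)
            fun q' s' l ↦ q' < q + 1 ∨ q' = q + 1 ∧ c ≤ s' i ∧ l = i).comap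
            ((m.flip (u j)).comp (b (u a))) := by
        refine wordSpan_le ?_
        rintro q'' s'' l h (hlt | ⟨rfl, hs, rfl⟩) hh
        · exact (hh.single a l).mem_wordSpan (Or.inl (by omega))
        · refine hh.exchange_right hbm hW _ a j ?_
          simp only [Pi.add_apply]
          omega
      exact hle (ihg k (s i - 1) (by omega))

theorem IsWord.repeat_left (h2 : (2 : K) ≠ 0) (hbm : IsBernsteinPair b m)
    (hW : ∀ i j, b (u i) (u j) ∈ W)
    {q D : ℕ} {s : ι → ℕ} {g : Module.End K U} (hg : IsWord b m u W q D s g) (i k : ι) :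
    m (b (u i) (g (u k))) (u i) ∈ wordSpan b m u W (D + 1) fun q' _ _ ↦ q' < q + 1 := by
  have hj := hbm.jacobi (u i) (g (u k)) (u i)
  rw [hbm.comm (g (u k)) (u i), ← two_smul K, add_eq_zero_iff_eq_neg] at hj
  rw [← Submodule.smul_mem_iff _ h2, hj]
  exact Submodule.neg_mem _
    ((IsWord.letter _ (hW i i) hg).mem_wordSpan (Nat.lt_succ_self q))

theorem IsWord.repeat_right (h2 : (2 : K) ≠ 0) (hbm : IsBernsteinPair b m)
    (hW : ∀ i j, b (u i) (u j) ∈ W)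
    {q D : ℕ} {s : ι → ℕ} {g : Module.End K U} (hg : IsWord b m u W q D s g) (i k : ι) :
    m (b (u k) (g (u i))) (u i) ∈ wordSpan b m u W (D + 1) fun q' _ _ ↦ q' < q + 1 := by
  obtain ⟨ε, hε⟩ := hg.exists_adj hbm
  rw [hε, map_smul]
  exact Submodule.smul_mem _ _ (hg.repeat_left h2 hbm hW i k)

theorem IsWord.apply_of_mem (h2 : (2 : K) ≠ 0) (hbm : IsBernsteinPair b m)
    (hW : ∀ i j, b (u i) (u j) ∈ W)
    {q D : ℕ} {s : ι → ℕ} {f : Module.End K U} (hf : IsWord b m u W q D s f) (i : ι) :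
    1 ≤ s i → f (u i) ∈ wordSpan b m u W D fun q' _ _ ↦ q' < q := by
  induction hf with
  | one => intro hc; simp at hc
  | letter v hv hf ih =>
    intro hc
    exact letter_apply_mem_wordSpan hv (ih hc)
  | @comp q D q' D' s s' g f a k hg hf ihg ihf =>
    intro hc
    simp only [Pi.add_apply] at hc
    by_cases h1 : 1 ≤ s' i
    · have := (hg.single a k).apply_mem_wordSpan
        (Q' := fun q'' _ _ ↦ q'' < q + q' + 1) (fun _ _ _ h ↦ by omega) (ihf h1)
      rwa [Nat.add_right_comm] at this
    · refine hf.apply_apply_mem hbm ?_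
      suffices h : m (b (u a) (g (u k))) (u i) ∈ wordSpan b m u W (D + 1)
          fun q' _ _ ↦ q' < q + 1 by
        have := hf.apply_mem_wordSpan
          (Q' := fun q'' _ _ ↦ q'' < q + q' + 1) (fun _ _ _ h ↦ by omega) h
        rwa [← add_assoc, add_comm D'] at this
      by_cases ha : a = i
      · subst ha
        exact hg.repeat_left h2 hbm hW a k
      by_cases hk : k = i
      · subst hk
        exact hg.repeat_right h2 hbm hW k a
      rw [Pi.single_eq_of_ne (Ne.symm ha), Pi.single_eq_of_ne (Ne.symm hk)] at hc
      have hle : wordSpan b m u W D (fun q' s' l ↦ q' < q ∨ q' = q ∧ 0 ≤ s' i ∧ l = i) ≤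
          (wordSpan b m u W (D + 1) fun q' _ _ ↦ q' < q + 1).comap
            ((m.flip (u i)).comp (b (u a))) := by
        refine wordSpan_le ?_
        rintro q'' s'' l h (hlt | ⟨rfl, -, rfl⟩) hh
        · exact (hh.single a l).mem_wordSpan (by omega)
        · exact hh.repeat_right h2 hbm hW _ a
      exact hle (hg.exchange hbm hW i k 0 (by omega))

theorem IsWord.apply_of_two_le (h2 : (2 : K) ≠ 0) (hbm : IsBernsteinPair b m)
    (hW : ∀ i j, b (u i) (u j) ∈ W) {q D : ℕ} {s : ι → ℕ} {f : Module.End K U}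
    (hf : IsWord b m u W q D s f) {i : ι} (hi : 2 ≤ s i) (j : ι) :
    f (u j) ∈ wordSpan b m u W D fun q' _ _ ↦ q' < q := by
  refine wordSpan_le ?_ (hf.exchange hbm hW i j 1 hi)
  rintro q'' s'' l h (hlt | ⟨rfl, hs, rfl⟩) hh
  · exact hh.mem_wordSpan hlt
  · exact hh.apply_of_mem h2 hbm hW _ hs

theorem IsWord.apply_mem_of_card [Fintype ι] (h2 : (2 : K) ≠ 0) (hbm : IsBernsteinPair b m)
    (hW : ∀ i j, b (u i) (u j) ∈ W) {q D : ℕ} {s : ι → ℕ} {f : Module.End K U}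
    (hf : IsWord b m u W q D s f) (j : ι) :
    f (u j) ∈ wordSpan b m u W D fun q' _ _ ↦ q' ≤ Fintype.card ι := by
  induction q using Nat.strong_induction_on generalizing s f j with
  | _ q ih =>
    by_cases hq : q ≤ Fintype.card ι
    · exact hf.mem_wordSpan hq
    · obtain ⟨i, -, hi⟩ : ∃ i ∈ Finset.univ, 1 < s i := by
        refine Finset.exists_lt_of_sum_lt (f := fun _ ↦ 1) ?_
        rw [hf.sum_content]
        simp
        omega
      refine wordSpan_le ?_ (hf.apply_of_two_le h2 hbm hW hi j)
      exact fun q' s' l h hlt hh ↦ ih q' hlt hh l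

theorem IsWord.mem_pow_mul_top (hbm : IsBernsteinPair b m) {d : ℕ} (hd : (W.map m) ^ (d + 1) = ⊥)
    {q D : ℕ} {s : ι → ℕ} {f : Module.End K U} (hf : IsWord b m u W q D s f) :
    ∃ t, f ∈ (W.map m) ^ t * (⊤ : Submodule K (Module.End K U)) ∧ D ≤ q + t + d * q := by
  have hmul : ∀ (v : V) (t : ℕ) (f : Module.End K U), f ∈ (W.map m) ^ t * (⊤ : Submodule K _) →
      m v * f ∈ (W.map m) ^ t * (⊤ : Submodule K (Module.End K U)) := by
    intro v t
    induction t with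
    | zero =>
      intro f _
      rw [pow_zero, one_mul]
      trivial
    | succ t ih =>
      intro f hf
      rw [pow_succ', mul_assoc] at hf ⊢
      refine Submodule.mul_induction_on hf ?_ ?_
      · rintro _ ⟨w, hw, rfl⟩ g hg
        rw [← mul_assoc (m v), hbm.anti v w, neg_mul, mul_assoc (m w)]
        exact Submodule.neg_mem _ (Submodule.mul_mem_mul ⟨w, hw, rfl⟩ (ih g hg))
      · intro x y hx hy
        rw [mul_add]
        exact Submodule.add_mem _ hx hy
  induction hf with
  | one => exact ⟨0, by simp, by simp⟩
  | letter v hv hf ih =>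
    obtain ⟨t, ht, hD⟩ := ih
    refine ⟨t + 1, ?_, by omega⟩
    rw [pow_succ', mul_assoc]
    exact Submodule.mul_mem_mul ⟨v, hv, rfl⟩ ht
  | @comp q D q' D' s s' g f a k hg hf ihg ihf =>
    obtain ⟨t, ht, hD⟩ := ihg
    obtain ⟨t', ht', hD'⟩ := ihf
    by_cases h : t ≤ d
    · refine ⟨t', hmul _ _ _ ht', ?_⟩
      have : d * (q + q' + 1) = d * q + d * q' + d := by ring
      omega
    · refine ⟨D + D' + 1, ?_, by omega⟩
      have hg0 : g = 0 := by
        have : (W.map m) ^ t = ⊥ := by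
          rw [← Nat.sub_add_cancel (show d + 1 ≤ t by omega), pow_add, hd, Submodule.mul_bot]
        rwa [this, Submodule.bot_mul, Submodule.mem_bot] at ht
      simp [hg0]

theorem IsWord.apply_eq_zero [Fintype ι] (h2 : (2 : K) ≠ 0) (hbm : IsBernsteinPair b m)
    (hW : ∀ i j, b (u i) (u j) ∈ W) {d : ℕ} (hd : (W.map m) ^ (d + 1) = ⊥)
    {q D : ℕ} {s : ι → ℕ} {f : Module.End K U}
    (hf : IsWord b m u W q D s f) (hD : Fintype.card ι + d + d * Fintype.card ι < D) (j : ι) :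
    f (u j) = 0 := by
  suffices h : wordSpan b m u W D (fun q' _ _ ↦ q' ≤ Fintype.card ι) ≤ ⊥ by
    exact (Submodule.mem_bot K).1 (h (hf.apply_mem_of_card h2 hbm hW j))
  refine wordSpan_le fun q' s' l g hq hg ↦ ?_
  obtain ⟨t, ht, hDt⟩ := hg.mem_pow_mul_top hbm hd
  have := Nat.mul_le_mul_left d hq
  rw [← Nat.sub_add_cancel (show d + 1 ≤ t by omega), pow_add, hd, Submodule.mul_bot,
    Submodule.bot_mul, Submodule.mem_bot] at ht
  simp [ht]

/-- The images in `End U` of `d` elements of `V` generate an algebra of nilpotency index at most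
`d + 1`. -/
theorem IsBernsteinPair.map_span_pow (h2 : (2 : K) ≠ 0) (hbm : IsBernsteinPair b m)
    (l : List V) : ((Submodule.span K {v | v ∈ l}).map m) ^ (l.length + 1) = ⊥ := by
  induction l with
  | nil => simp
  | cons v l ih =>
    have hset : {w | w ∈ v :: l} = insert v {w | w ∈ l} := by
      ext; simp
    rw [hset, Submodule.span_insert, Submodule.map_sup]
    refine Commute.add_pow_eq_zero_of_add_le_succ_of_pow_eq_zero (m := 2) ?_ ?_ ih ?_
    · rw [commute_iff_eq, Submodule.map_span, Submodule.map_span, Submodule.span_mul_span,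
        Submodule.span_mul_span]
      refine le_antisymm (Submodule.span_le.2 ?_) (Submodule.span_le.2 ?_)
      · rintro _ ⟨_, ⟨x, hx, rfl⟩, _, ⟨y, hy, rfl⟩, rfl⟩
        simp only [hbm.anti x y]
        exact Submodule.neg_mem _ (Submodule.subset_span ⟨_, ⟨y, hy, rfl⟩, _, ⟨x, hx, rfl⟩, rfl⟩)
      · rintro _ ⟨_, ⟨x, hx, rfl⟩, _, ⟨y, hy, rfl⟩, rfl⟩
        simp only [hbm.anti x y]
        exact Submodule.neg_mem _ (Submodule.subset_span ⟨_, ⟨y, hy, rfl⟩, _, ⟨x, hx, rfl⟩, rfl⟩)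
    · have hv : m v * m v = 0 := by
        have := hbm.anti v v
        rw [eq_neg_iff_add_eq_zero, ← two_smul K] at this
        exact (smul_eq_zero.1 this).resolve_left h2
      rw [Submodule.map_span, Set.image_singleton, sq, Submodule.span_mul_span]
      simp [hv]
    · simp; omega

/-- The span of the values at the `u j` of all words with at least `D` letters. -/
def longWordSpan (b : U →ₗ[K] U →ₗ[K] V) (m : V →ₗ[K] Module.End K U)
    (u : ι → U) (W : Submodule K V) (D : ℕ) : Submodule K U :=
  Submodule.span K {x | ∃ q D' s j f, D ≤ D' ∧ IsWord b m u W q D' s f ∧ f (u j) = x}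

theorem IsWord.mem_longWordSpan {q D D' : ℕ} {s : ι → ℕ} {f : Module.End K U}
    (hf : IsWord b m u W q D' s f) (hD : D ≤ D') (j : ι) :
    f (u j) ∈ longWordSpan b m u W D :=
  Submodule.subset_span ⟨q, D', s, j, f, hD, hf, rfl⟩

theorem longWordSpan_le {D : ℕ} {X : Submodule K U}
    (h : ∀ q D' s j f, D ≤ D' → IsWord b m u W q D' s f → f (u j) ∈ X) :
    longWordSpan b m u W D ≤ X := by
  refine Submodule.span_le.2 ?_
  rintro _ ⟨q, D', s, j, f, hD, hf, rfl⟩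
  exact h q D' s j f hD hf

theorem longWordSpan_anti {D D' : ℕ} (h : D ≤ D') :
    longWordSpan b m u W D' ≤ longWordSpan b m u W D :=
  longWordSpan_le fun _ _ _ j _ hD hf ↦ hf.mem_longWordSpan (h.trans hD) j

theorem span_range_le_longWordSpan :
    Submodule.span K (Set.range u) ≤ longWordSpan b m u W 0 := by
  refine Submodule.span_le.2 ?_
  rintro _ ⟨j, rfl⟩
  exact IsWord.one.mem_longWordSpan le_rfl j

theorem letter_apply_mem_longWordSpan {D : ℕ} {v : V} (hv : v ∈ W) {x : U}
    (hx : x ∈ longWordSpan b m u W D) : m v x ∈ longWordSpan b m u W (D + 1) := by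
  have : longWordSpan b m u W D ≤ (longWordSpan b m u W (D + 1)).comap (m v) :=
    longWordSpan_le fun q D' s j g h hg ↦
      (IsWord.letter v hv hg).mem_longWordSpan (Nat.succ_le_succ h) j
  exact this hx

theorem comp_apply_mem_longWordSpan {D : ℕ} {y : V} {z : U}
    (hy : y ∈ Submodule.map₂ b (Submodule.span K (Set.range u)) (longWordSpan b m u W D))
    (hz : z ∈ Submodule.span K (Set.range u)) : m y z ∈ longWordSpan b m u W (D + 1) := by
  have h : Submodule.span K (Set.range u) ≤ (longWordSpan b m u W (D + 1)).comap (m y) := by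
    refine Submodule.span_le.2 ?_
    rintro _ ⟨j, rfl⟩
    have hspan : Submodule.map₂ b (Submodule.span K (Set.range u)) (longWordSpan b m u W D) ≤
        (longWordSpan b m u W (D + 1)).comap (m.flip (u j)) := by
      rw [longWordSpan, Submodule.map₂_span_span]
      refine Submodule.span_le.2 ?_
      rintro _ ⟨_, ⟨i, rfl⟩, _, ⟨q, D', s, k, f, hD, hf, rfl⟩, rfl⟩
      exact (hf.single i k).mem_longWordSpan (Nat.succ_le_succ hD) j
    exact hspan hy
  exact h hz

/-- The product of `U × V` given by `(x, v) (y, w) = (m v y + m w x, b x y)`. -/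
def pairMul (b : U →ₗ[K] U →ₗ[K] V) (m : V →ₗ[K] Module.End K U) :
    (U × V) →ₗ[K] (U × V) →ₗ[K] (U × V) :=
  LinearMap.mk₂ K (fun x y ↦ (m x.2 y.1 + m y.2 x.1, b x.1 y.1))
    (fun x x' y ↦ by simp; abel) (fun c x y ↦ by simp)
    (fun x y y' ↦ by simp; abel) (fun c x y ↦ by simp)

theorem pairMul_apply (x y : U × V) :
    pairMul b m x y = (m x.2 y.1 + m y.2 x.1, b x.1 y.1) := rfl

theorem IsBernsteinPair.iterate_pairMul_eq_bot [Fintype ι] (h2 : (2 : K) ≠ 0)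
    (hbm : IsBernsteinPair b m) (hW : ∀ i j, b (u i) (u j) ∈ W) {d : ℕ}
    (hd : (W.map m) ^ (d + 1) = ⊥) {S X : Submodule K (U × V)}
    (hS : S ≤ (Submodule.span K (Set.range u)).prod W)
    (hX : X ≤ (Submodule.span K (Set.range u)).prod W) :
    (Submodule.map₂ (pairMul b m) S)^[2 * (Fintype.card ι + d + d * Fintype.card ι) + 3] X =
      ⊥ := by
  set Z := Submodule.span K (Set.range u)
  have key : ∀ D, (Submodule.map₂ (pairMul b m) S)^[2 * D + 1] X ≤
      (longWordSpan b m u W (D + 1)).prod (Submodule.map₂ b Z (longWordSpan b m u W D)) := by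
    intro D
    induction D with
    | zero =>
      rw [Nat.mul_zero, Nat.zero_add, Function.iterate_one]
      refine Submodule.map₂_le.2 fun x hx y hy ↦ ⟨Submodule.add_mem _ ?_ ?_, ?_⟩
      · exact letter_apply_mem_longWordSpan (hS hx).2 (span_range_le_longWordSpan (hX hy).1)
      · exact letter_apply_mem_longWordSpan (hX hy).2 (span_range_le_longWordSpan (hS hx).1)
      · exact Submodule.apply_mem_map₂ _ (hS hx).1 (span_range_le_longWordSpan (hX hy).1)
    | succ D ih =>
      have h1 : (Submodule.map₂ (pairMul b m) S)^[2 * D + 2] X ≤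
          (longWordSpan b m u W (D + 1)).prod
            (Submodule.map₂ b Z (longWordSpan b m u W (D + 1))) := by
        rw [Function.iterate_succ_apply']
        refine Submodule.map₂_le.2 fun x hx y hy ↦ ⟨Submodule.add_mem _ ?_ ?_, ?_⟩
        · exact longWordSpan_anti (Nat.le_succ _)
            (letter_apply_mem_longWordSpan (hS hx).2 (ih hy).1)
        · exact comp_apply_mem_longWordSpan (ih hy).2 (hS hx).1
        · exact Submodule.apply_mem_map₂ _ (hS hx).1 (ih hy).1
      rw [show 2 * (D + 1) + 1 = (2 * D + 2) + 1 by ring, Function.iterate_succ_apply']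
      refine Submodule.map₂_le.2 fun x hx y hy ↦ ⟨Submodule.add_mem _ ?_ ?_, ?_⟩
      · exact letter_apply_mem_longWordSpan (hS hx).2 (h1 hy).1
      · exact comp_apply_mem_longWordSpan (h1 hy).2 (hS hx).1
      · exact Submodule.apply_mem_map₂ _ (hS hx).1 (h1 hy).1
  have hzero : ∀ D, Fintype.card ι + d + d * Fintype.card ι < D → longWordSpan b m u W D = ⊥ := by
    intro D hD
    refine le_bot_iff.1 (longWordSpan_le fun q D' s j f h hf ↦ ?_)
    exact (Submodule.mem_bot K).2 (hf.apply_eq_zero h2 hbm hW hd (hD.trans_le h) j)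
  have := key (Fintype.card ι + d + d * Fintype.card ι + 1)
  rw [hzero _ (by omega), hzero _ (by omega), Submodule.map₂_bot_right, Submodule.prod_bot] at this
  exact le_bot_iff.1 this

/-- Finitely generated subspaces of a Bernstein pair act nilpotently by multiplication. -/
theorem IsBernsteinPair.exists_iterate_pairMul_eq_bot {b : U →ₗ[K] U →ₗ[K] V}
    {m : V →ₗ[K] Module.End K U} (h2 : (2 : K) ≠ 0) (hbm : IsBernsteinPair b m)
    {S : Submodule K (U × V)} (hS : S.FG) :
    ∃ M, ∀ c, (Submodule.map₂ (pairMul b m) S)^[M] (Submodule.span K {c}) = ⊥ := by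
  classical
  obtain ⟨t, rfl⟩ := hS
  set n := t.card + 1 with hn
  set d := n + n * n with hd
  refine ⟨2 * (n + d + d * n) + 3, fun c ↦ ?_⟩
  set u : Option t → U := fun i ↦ i.elim c.1 fun x ↦ x.1.1 with hu
  set l : List V := (Finset.univ : Finset (Option t)).toList.map (fun i ↦ i.elim c.2 fun x ↦ x.1.2)
    ++ (Finset.univ : Finset (Option t × Option t)).toList.map (fun p ↦ b (u p.1) (u p.2)) with hl
  have hcard : Fintype.card (Option t) = n := by simp [hn]
  have hlen : l.length = d := by simp [hl, hd, hcard, hn]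
  have hmem : ∀ i : Option t, (i.elim c fun x ↦ x.1 : U × V) ∈
      (Submodule.span K (Set.range u)).prod (Submodule.span K {v | v ∈ l}) := by
    intro i
    refine ⟨Submodule.subset_span ⟨i, by cases i <;> rfl⟩, Submodule.subset_span ?_⟩
    refine List.mem_append_left _ (List.mem_map.2 ⟨i, by simp, by cases i <;> rfl⟩)
  have := hbm.iterate_pairMul_eq_bot (u := u) (W := Submodule.span K {v | v ∈ l})
    (d := d) (S := Submodule.span K t) (X := Submodule.span K {c}) h2 ?_ ?_ ?_ ?_
  · rwa [hcard] at this
  · intro i j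
    refine Submodule.subset_span (List.mem_append_right _ (List.mem_map.2 ⟨(i, j), by simp, rfl⟩))
  · rw [← hlen]
    exact hbm.map_span_pow h2 l
  · exact Submodule.span_le.2 fun x hx ↦ hmem (some ⟨x, hx⟩)
  · exact Submodule.span_le.2 (by rintro _ rfl; exact hmem none)

theorem pairMul_comm (hbm : IsBernsteinPair b m) (x y : U × V) :
    pairMul b m x y = pairMul b m y x := by
  rw [pairMul_apply, pairMul_apply, hbm.comm, add_comm]

theorem pairMul_jacobi (hbm : IsBernsteinPair b m) (x y z : U × V) :
    pairMul b m x (pairMul b m y z) + pairMul b m y (pairMul b m z x) +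
      pairMul b m z (pairMul b m x y) = 0 := by
  have anti : ∀ v w a, m v (m w a) = -m w (m v a) := fun v w a ↦
    LinearMap.congr_fun (hbm.anti v w) a
  have hj := hbm.jacobi x.1 y.1 z.1
  simp only [pairMul_apply, Prod.mk_add_mk, map_add]
  refine Prod.ext ?_ ?_
  · rw [anti x.2 z.2, anti y.2 x.2, anti z.2 y.2]
    simp only [Prod.fst_zero]
    rw [← hj]
    abel
  · rw [hbm.skew x.1 y.2, hbm.skew y.1 z.2, hbm.skew z.1 x.2]
    simp only [Prod.snd_zero]
    abel

end Words

section Artinian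

variable {K N : Type*} [Field K] [AddCommGroup N] [Module K N] {μ : N →ₗ[K] N →ₗ[K] N}

/-- A subspace stable under all multiplications `μ n`. -/
def IsMulIdeal (μ : N →ₗ[K] N →ₗ[K] N) (I : Submodule K N) : Prop :=
  ∀ n, ∀ x ∈ I, μ n x ∈ I

/-- The descending chain condition for ideals. -/
def MulDCC (μ : N →ₗ[K] N →ₗ[K] N) : Prop :=
  ∀ f : ℕ → Submodule K N, (∀ k, IsMulIdeal μ (f k)) → Antitone f →
    ∃ n, ∀ m, n ≤ m → f m = f n

/-- Finitely generated subspaces act nilpotently. -/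
def LocallyNilpotent (μ : N →ₗ[K] N →ₗ[K] N) : Prop :=
  ∀ S : Submodule K N, S.FG → ∃ M, ∀ c, (Submodule.map₂ μ S)^[M] (Submodule.span K {c}) = ⊥

theorem isMulIdeal_iff {I : Submodule K N} : IsMulIdeal μ I ↔ Submodule.map₂ μ ⊤ I ≤ I :=
  ⟨fun h ↦ Submodule.map₂_le.2 fun n _ x hx ↦ h n x hx,
    fun h _ _ hx ↦ h (Submodule.apply_mem_map₂ _ trivial hx)⟩

theorem IsMulIdeal.map₂_le {I : Submodule K N} (hI : IsMulIdeal μ I) (S : Submodule K N) :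
    Submodule.map₂ μ S I ≤ I :=
  Submodule.map₂_le.2 fun n _ x hx ↦ hI n x hx

theorem IsMulIdeal.map₂_top {I : Submodule K N} (hI : IsMulIdeal μ I) :
    IsMulIdeal μ (Submodule.map₂ μ ⊤ I) :=
  fun _ _ hx ↦ Submodule.apply_mem_map₂ _ trivial (hI.map₂_le ⊤ hx)

theorem IsMulIdeal.iterate {I : Submodule K N} (hI : IsMulIdeal μ I) (k : ℕ) :
    IsMulIdeal μ ((Submodule.map₂ μ ⊤)^[k] I) := by
  induction k with
  | zero => exact hI
  | succ k ih => rw [Function.iterate_succ_apply']; exact ih.map₂_top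

theorem IsMulIdeal.antitone_iterate {I : Submodule K N} (hI : IsMulIdeal μ I) :
    Antitone fun k ↦ (Submodule.map₂ μ ⊤)^[k] I := by
  refine antitone_nat_of_succ_le fun k ↦ ?_
  rw [Function.iterate_succ_apply']
  exact (hI.iterate k).map₂_le ⊤

theorem iterate_map₂_mono {S S' X X' : Submodule K N} (hS : S ≤ S') (hX : X ≤ X') (k : ℕ) :
    (Submodule.map₂ μ S)^[k] X ≤ (Submodule.map₂ μ S')^[k] X' := by
  induction k with
  | zero => exact hX
  | succ k ih =>
    rw [Function.iterate_succ_apply', Function.iterate_succ_apply']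
    exact Submodule.map₂_le_map₂ hS ih

theorem iterate_map₂_iSup {α : Sort*} (S : Submodule K N) (X : α → Submodule K N) (k : ℕ) :
    (Submodule.map₂ μ S)^[k] (⨆ i, X i) = ⨆ i, (Submodule.map₂ μ S)^[k] (X i) := by
  induction k with
  | zero => rfl
  | succ k ih => simp only [Function.iterate_succ_apply', ih, Submodule.map₂_iSup_right]

theorem LocallyNilpotent.exists_iterate_eq_bot (h : LocallyNilpotent μ) {S : Submodule K N}
    (hS : S.FG) : ∃ M, ∀ X, (Submodule.map₂ μ S)^[M] X = ⊥ := by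
  obtain ⟨M, hM⟩ := h S hS
  refine ⟨M, fun X ↦ ?_⟩
  rw [← Submodule.span_eq X, Submodule.span_eq_iSup_of_singleton_spans]
  simp [iterate_map₂_iSup, hM]

theorem LocallyNilpotent.le_of_le_sup (h : LocallyNilpotent μ) {S X J : Submodule K N}
    (hS : S.FG) (hJ : IsMulIdeal μ J) (hX : X ≤ Submodule.map₂ μ S X ⊔ J) : X ≤ J := by
  obtain ⟨M, hM⟩ := h.exists_iterate_eq_bot hS
  have key : ∀ k, X ≤ (Submodule.map₂ μ S)^[k] X ⊔ J := by
    intro k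
    induction k with
    | zero => exact le_sup_left
    | succ k ih =>
      rw [Function.iterate_succ_apply']
      refine hX.trans (sup_le ((Submodule.map₂_le_map₂_right ih).trans ?_) le_sup_right)
      rw [Submodule.map₂_sup_right]
      exact sup_le_sup_left (hJ.map₂_le S) _
  simpa [hM] using key M

theorem isMulIdeal_bot : IsMulIdeal μ ⊥ := by
  intro n x hx
  simp [(Submodule.mem_bot K).1 hx]

theorem LocallyNilpotent.eq_bot_of_le (h : LocallyNilpotent μ) {S X : Submodule K N}
    (hS : S.FG) (hX : X ≤ Submodule.map₂ μ S X) : X = ⊥ :=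
  le_bot_iff.1 (h.le_of_le_sup hS isMulIdeal_bot (hX.trans le_sup_left))

theorem MulDCC.exists_minimal (h : MulDCC μ) {p : Submodule K N → Prop} {I : Submodule K N}
    (hI : IsMulIdeal μ I) (hp : p I) :
    ∃ J, IsMulIdeal μ J ∧ p J ∧ ∀ J', IsMulIdeal μ J' → p J' → J' ≤ J → J' = J := by
  have hwf : WellFoundedGT {I // IsMulIdeal μ I}ᵒᵈ := by
    rw [wellFoundedGT_iff_monotone_chain_condition]
    intro a
    obtain ⟨n, hn⟩ := h (fun k ↦ (OrderDual.ofDual (a k)).1) (fun k ↦ (OrderDual.ofDual (a k)).2)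
      fun i j hij ↦ a.monotone hij
    exact ⟨n, fun m hm ↦ OrderDual.ofDual.injective (Subtype.ext (hn m hm).symm)⟩
  have hwf' : WellFounded ((· < ·) : {I // IsMulIdeal μ I} → {I // IsMulIdeal μ I} → Prop) :=
    hwf.wf
  obtain ⟨J, hJ, hmin⟩ := hwf'.has_min {J | p J.1} ⟨⟨I, hI⟩, hp⟩
  refine ⟨J.1, J.2, hJ, fun J' hJ' hp' hle ↦ ?_⟩
  by_contra hne
  exact hmin ⟨J', hJ'⟩ hp' (lt_of_le_of_ne hle fun h ↦ hne (congrArg Subtype.val h))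

theorem MulDCC.exists_fg_sup (h : MulDCC μ) {I J : Submodule K N} (hJI : J ≤ I)
    (hIJ : Submodule.map₂ μ ⊤ I ≤ J) : ∃ S : Submodule K N, S.FG ∧ I = J ⊔ S := by
  have hid : ∀ X : Submodule K N, J ≤ X → X ≤ I → IsMulIdeal μ X := fun X h1 h2 ↦
    isMulIdeal_iff.2 ((Submodule.map₂_le_map₂_right h2).trans (hIJ.trans h1))
  obtain ⟨X, -, ⟨hJX, hXI, S, hS, hXS⟩, hmin⟩ := h.exists_minimal
    (p := fun X ↦ J ≤ X ∧ X ≤ I ∧ ∃ S : Submodule K N, S.FG ∧ I = X ⊔ S) (hid I hJI le_rfl)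
    ⟨hJI, le_rfl, ⊥, Submodule.fg_bot, by simp⟩
  suffices X ≤ J by
    obtain rfl := le_antisymm this hJX
    exact ⟨S, hS, hXS⟩
  intro x hx
  by_contra hxJ
  obtain ⟨C, hC⟩ := Submodule.exists_isCompl (J ⊔ Submodule.span K {x})
  have hxX : Submodule.span K {x} ≤ X := (Submodule.span_singleton_le_iff_mem _ _).2 hx
  have h1 : J ⊔ C ⊓ X ⊔ Submodule.span K {x} = X := by
    rw [sup_right_comm, ← sup_inf_assoc_of_le C (sup_le hJX hxX), hC.sup_eq_top, top_inf_eq]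
  have h2 : J ⊔ C ⊓ X ≤ X := sup_le hJX inf_le_right
  have h3 := hmin (J ⊔ C ⊓ X) (hid _ le_sup_left (h2.trans hXI))
    ⟨le_sup_left, h2.trans hXI, Submodule.span K {x} ⊔ S, (Submodule.fg_span_singleton x).sup hS,
      by rw [← sup_assoc, h1, hXS]⟩ h2
  rw [← h3] at hx
  obtain ⟨j, hj, c, hc, rfl⟩ := Submodule.mem_sup.1 hx
  have hc' : c ∈ J ⊔ Submodule.span K {j + c} := by
    have := sub_mem (Submodule.mem_sup_right (Submodule.mem_span_singleton_self (R := K) (j + c)))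
      (Submodule.mem_sup_left (T := Submodule.span K {j + c}) hj)
    simpa using this
  have hc0 : c = 0 := by
    have : c ∈ (J ⊔ Submodule.span K {j + c}) ⊓ C := ⟨hc', hc.1⟩
    rwa [hC.inf_eq_bot, Submodule.mem_bot] at this
  exact hxJ (by simpa [hc0] using hj)

theorem MulDCC.exists_fg_sup_iterate (h : MulDCC μ) {I : Submodule K N} (hI : IsMulIdeal μ I)
    (k : ℕ) : ∃ S : Submodule K N, S.FG ∧ I = (Submodule.map₂ μ ⊤)^[k] I ⊔ S := by
  induction k generalizing I with
  | zero => exact ⟨⊥, Submodule.fg_bot, by simp⟩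
  | succ k ih =>
    obtain ⟨S, hS, h1⟩ := ih hI.map₂_top
    obtain ⟨S', hS', h2⟩ := h.exists_fg_sup (hI.map₂_le ⊤) le_rfl
    exact ⟨S ⊔ S', hS.sup hS', by rw [Function.iterate_succ_apply, ← sup_assoc, ← h1, ← h2]⟩

theorem MulDCC.exists_iterate_eq (h : MulDCC μ) {I : Submodule K N} (hI : IsMulIdeal μ I) :
    ∃ k, Submodule.map₂ μ ⊤ ((Submodule.map₂ μ ⊤)^[k] I) = (Submodule.map₂ μ ⊤)^[k] I := by
  obtain ⟨k, hk⟩ := h _ hI.iterate hI.antitone_iterate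
  exact ⟨k, by simpa only [Function.iterate_succ_apply'] using hk (k + 1) k.le_succ⟩

theorem exists_fg_le_map₂_sup {D J D' : Submodule K N} (hD' : D'.FG)
    (h : D' ≤ Submodule.map₂ μ ⊤ D ⊔ J) :
    ∃ S : Submodule K N, S.FG ∧ D' ≤ Submodule.map₂ μ S D ⊔ J := by
  have key : ∀ x ∈ Submodule.map₂ μ ⊤ D, ∃ S : Submodule K N, S.FG ∧ x ∈ Submodule.map₂ μ S D := by
    intro x hx
    rw [Submodule.map₂_eq_span_image2] at hx
    induction hx using Submodule.span_induction with
    | mem x hx =>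
      obtain ⟨n, -, d, hd, rfl⟩ := hx
      exact ⟨Submodule.span K {n}, Submodule.fg_span_singleton n,
        Submodule.apply_mem_map₂ _ (Submodule.mem_span_singleton_self n) hd⟩
    | zero => exact ⟨⊥, Submodule.fg_bot, zero_mem _⟩
    | add x y _ _ hx hy =>
      obtain ⟨S, hS, hx⟩ := hx
      obtain ⟨T, hT, hy⟩ := hy
      exact ⟨S ⊔ T, hS.sup hT, add_mem (Submodule.map₂_le_map₂_left le_sup_left hx)
        (Submodule.map₂_le_map₂_left le_sup_right hy)⟩
    | smul c x _ hx =>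
      obtain ⟨S, hS, hx⟩ := hx
      exact ⟨S, hS, Submodule.smul_mem _ c hx⟩
  induction D', hD' using Submodule.fg_induction with
  | singleton x =>
    obtain ⟨y, hy, j, hj, hyj⟩ := Submodule.mem_sup.1 (h (Submodule.mem_span_singleton_self x))
    obtain ⟨S, hS, hy⟩ := key y hy
    refine ⟨S, hS, (Submodule.span_singleton_le_iff_mem _ _).2 ?_⟩
    rw [← hyj]
    exact Submodule.add_mem_sup hy hj
  | sup A B _ _ hA hB =>
    obtain ⟨S, hS, hA⟩ := hA (le_sup_left.trans h)
    obtain ⟨T, hT, hB⟩ := hB (le_sup_right.trans h)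
    exact ⟨S ⊔ T, hS.sup hT, sup_le
      (hA.trans (sup_le_sup_right (Submodule.map₂_le_map₂_left le_sup_left) _))
      (hB.trans (sup_le_sup_right (Submodule.map₂_le_map₂_left le_sup_right) _))⟩

theorem LocallyNilpotent.eq_of_cofinite (h : LocallyNilpotent μ) {P J D : Submodule K N}
    (hP : Submodule.map₂ μ ⊤ P = P) (hJ : IsMulIdeal μ J) (hD : D.FG) (hPJ : P = J ⊔ D) :
    P = J := by
  have h1 : D ≤ Submodule.map₂ μ ⊤ D ⊔ J := by
    have : D ≤ Submodule.map₂ μ ⊤ (J ⊔ D) := by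
      rw [← hPJ, hP, hPJ]
      exact le_sup_right
    rw [Submodule.map₂_sup_right, sup_comm] at this
    exact this.trans (sup_le_sup_left (hJ.map₂_le ⊤) _)
  obtain ⟨S, hS, h2⟩ := exists_fg_le_map₂_sup hD h1
  rw [hPJ, sup_eq_left]
  exact h.le_of_le_sup hS hJ h2

theorem LocallyNilpotent.eq_bot_of_principal (h : LocallyNilpotent μ) {P : Submodule K N} {p : N}
    (hP : Submodule.map₂ μ ⊤ P = P) (hp : ∀ I, IsMulIdeal μ I → p ∈ I → P ≤ I) (hpP : p ∈ P) :
    P = ⊥ := by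
  set G : Submodule K N → Submodule K N := fun S ↦
    ⨆ j : ℕ, (Submodule.map₂ μ S)^[j + 1] (Submodule.span K {p}) with hG
  have hGmono : Monotone G := fun S T hST ↦ iSup_mono fun j ↦ iterate_map₂_mono hST le_rfl _
  set Y : Submodule K N := ⨆ S : {S : Submodule K N // S.FG}, G S with hY
  have hmemY : ∀ x, x ∈ Y ↔ ∃ S : Submodule K N, S.FG ∧ x ∈ G S := by
    intro x
    have : Nonempty {S : Submodule K N // S.FG} := ⟨⟨⊥, Submodule.fg_bot⟩⟩
    rw [hY, Submodule.mem_iSup_of_directed]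
    · simp
    · exact fun S T ↦ ⟨⟨S.1 ⊔ T.1, S.2.sup T.2⟩, hGmono le_sup_left, hGmono le_sup_right⟩
  have hGS : ∀ S, Submodule.map₂ μ S (Submodule.span K {p} ⊔ G S) = G S := by
    intro S
    have : Submodule.span K {p} ⊔ G S =
        ⨆ j : ℕ, (Submodule.map₂ μ S)^[j] (Submodule.span K {p}) := by
      rw [← sup_iSup_nat_succ]
      rfl
    rw [this, Submodule.map₂_iSup_right]
    simp only [hG, Function.iterate_succ_apply']
  have hNY : Submodule.map₂ μ ⊤ (Submodule.span K {p} ⊔ Y) ≤ Y := by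
    rw [Submodule.map₂_sup_right]
    refine sup_le (Submodule.map₂_le.2 fun n _ x hx ↦ ?_) (Submodule.map₂_le.2 fun n _ x hx ↦ ?_)
    · refine (hmemY _).2 ⟨Submodule.span K {n}, Submodule.fg_span_singleton n, ?_⟩
      rw [← hGS]
      exact Submodule.apply_mem_map₂ _ (Submodule.mem_span_singleton_self n)
        (Submodule.mem_sup_left hx)
    · obtain ⟨S, hS, hx⟩ := (hmemY x).1 hx
      refine (hmemY _).2 ⟨S ⊔ Submodule.span K {n}, hS.sup (Submodule.fg_span_singleton n), ?_⟩
      rw [← hGS]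
      exact Submodule.apply_mem_map₂ _ (Submodule.mem_sup_right
        (Submodule.mem_span_singleton_self n)) (Submodule.mem_sup_right (hGmono le_sup_left hx))
  have hPY : P ≤ Y := by
    rw [← hP]
    refine (Submodule.map₂_le_map₂_right (hp _ (isMulIdeal_iff.2 (hNY.trans le_sup_right)) ?_)).trans
      hNY
    exact Submodule.mem_sup_left (Submodule.mem_span_singleton_self p)
  obtain ⟨S, hS, hpS⟩ := (hmemY p).1 (hPY hpP)
  have hbot : G S = ⊥ := by
    refine h.eq_bot_of_le hS ?_
    conv_lhs => rw [← hGS S]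
    refine Submodule.map₂_le_map₂_right (sup_le ?_ le_rfl)
    exact (Submodule.span_singleton_le_iff_mem _ _).2 hpS
  exact le_bot_iff.1 (hp ⊥ isMulIdeal_bot (hbot ▸ hpS))

theorem Submodule.exists_fg_sup_inf_ker {E : Type*} [AddCommGroup E] [Module K E]
    [FiniteDimensional K E] (f : N →ₗ[K] E) (P : Submodule K N) :
    ∃ D : Submodule K N, D.FG ∧ P = P ⊓ LinearMap.ker f ⊔ D := by
  obtain ⟨C, hC⟩ := Submodule.exists_isCompl (LinearMap.ker (f.domRestrict P))
  have : FiniteDimensional K C := by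
    refine Module.Finite.of_injective ((f.domRestrict P).domRestrict C) ?_
    rw [← LinearMap.ker_eq_bot, LinearMap.ker_domRestrict,
      ← Submodule.disjoint_iff_comap_eq_bot]
    exact hC.symm.disjoint
  refine ⟨C.map P.subtype, (Module.Finite.iff_fg.1 this).map _, ?_⟩
  have := congrArg (Submodule.map P.subtype) hC.sup_eq_top
  rw [Submodule.map_sup, Submodule.map_subtype_top, LinearMap.ker_domRestrict,
    Submodule.map_comap_subtype] at this
  exact this.symm

/-- An Artinian, locally nilpotent algebra satisfying the Jacobi-type identity is nilpotent. -/
theorem LocallyNilpotent.exists_iterate_top_eq_bot (h : LocallyNilpotent μ) (hdcc : MulDCC μ)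
    (hcomm : ∀ x y, μ x y = μ y x)
    (hjac : ∀ x y z, μ x (μ y z) + μ y (μ z x) + μ z (μ x y) = 0) :
    ∃ k, (Submodule.map₂ μ ⊤)^[k] ⊤ = ⊥ := by
  have htop : IsMulIdeal μ ⊤ := fun _ _ _ ↦ trivial
  obtain ⟨k, hk⟩ := hdcc.exists_iterate_eq htop
  obtain ⟨S, hS, hS'⟩ := hdcc.exists_fg_sup_iterate htop k
  have hP₀id := htop.iterate k
  refine ⟨k, ?_⟩
  set P₀ := (Submodule.map₂ μ ⊤)^[k] ⊤
  by_contra hP₀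
  obtain ⟨P, hPid, ⟨hPne, hP⟩, hmin⟩ := hdcc.exists_minimal
    (p := fun P ↦ P ≠ ⊥ ∧ Submodule.map₂ μ ⊤ P = P) hP₀id ⟨hP₀, hk⟩
  have hann : ∀ p ∈ P, ∀ a ∈ P₀, μ a p = 0 := by
    intro p hp
    set Q : Submodule K N := sInf {I | IsMulIdeal μ I ∧ p ∈ I} with hQ
    have hQid : IsMulIdeal μ Q := fun n x hx ↦ Submodule.mem_sInf.2 fun I hI ↦
      hI.1 n x (Submodule.mem_sInf.1 hx I hI)
    have hpQ : p ∈ Q := Submodule.mem_sInf.2 fun I hI ↦ hI.2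
    have hQP : Q ≤ P := sInf_le ⟨hPid, hp⟩
    obtain ⟨l, hl⟩ := hdcc.exists_iterate_eq hQid
    have hlQ : (Submodule.map₂ μ ⊤)^[l] Q ≤ Q := hQid.antitone_iterate l.zero_le
    have hQbot : (Submodule.map₂ μ ⊤)^[l] Q = ⊥ := by
      by_contra hne
      have := hmin _ (hQid.iterate l) ⟨hne, hl⟩ (hlQ.trans hQP)
      rw [this] at hlQ
      exact hPne (h.eq_bot_of_principal hP (fun I hI hpI ↦ hlQ.trans (sInf_le ⟨hI, hpI⟩)) hp)
    have hQfg : Q.FG := by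
      obtain ⟨T, hT, hT'⟩ := hdcc.exists_fg_sup_iterate hQid l
      rw [hQbot, bot_sup_eq] at hT'
      rwa [hT']
    obtain ⟨t, ht⟩ := id hQfg
    have htQ : ∀ x : t, (x : N) ∈ Q := fun x ↦ ht ▸ Submodule.subset_span x.2
    have : FiniteDimensional K Q := Module.Finite.iff_fg.2 hQfg
    set φ : N →ₗ[K] t → Q := LinearMap.pi fun x ↦
      (μ.flip x).codRestrict Q fun n ↦ hQid n x (htQ x)
    have hφ : ∀ n, n ∈ LinearMap.ker φ ↔ ∀ x ∈ Q, μ n x = 0 := by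
      intro n
      constructor
      · intro hn x hx
        have hle : Q ≤ LinearMap.ker (μ n) := by
          rw [← ht, Submodule.span_le]
          intro y hy
          exact congrArg Subtype.val (congrFun (LinearMap.mem_ker.1 hn) ⟨y, hy⟩)
        exact hle hx
      · intro hn
        exact LinearMap.mem_ker.2 (funext fun x ↦ Subtype.ext (hn x (htQ x)))
    obtain ⟨D, hD, hP₀D⟩ := Submodule.exists_fg_sup_inf_ker φ P₀
    have hJ : IsMulIdeal μ (P₀ ⊓ LinearMap.ker φ) := by
      refine fun n a ha ↦ ⟨hP₀id n a ha.1, (hφ _).2 fun x hx ↦ ?_⟩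
      have h1 := (hφ a).1 ha.2
      have := hjac x n a
      rw [h1 x hx, h1 (μ x n) (by rw [hcomm]; exact hQid n x hx), map_zero, add_zero,
        add_zero] at this
      rwa [hcomm]
    have hle : P₀ ≤ LinearMap.ker φ := by
      rw [h.eq_of_cofinite hk hJ hD hP₀D]
      exact inf_le_right
    exact fun a ha ↦ (hφ a).1 (hle ha) p hpQ
  refine hPne (h.eq_bot_of_le hS ?_)
  conv_lhs => rw [← hP, hS', Submodule.map₂_sup_left]
  exact sup_le (Submodule.map₂_le.2 fun a ha p hp ↦ by rw [hann p hp a ha]; exact zero_mem _) le_rfl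

/-- The descending chain condition only has to be checked on ideals stable under an involution. -/
theorem MulDCC.of_involution {σ : N →ₗ[K] N} (hσ : ∀ x, σ (σ x) = x)
    (hμ : ∀ x y, σ (μ x y) = μ (σ x) (σ y))
    (h : ∀ f : ℕ → Submodule K N, (∀ k, IsMulIdeal μ (f k)) → (∀ k, ∀ x ∈ f k, σ x ∈ f k) →
      Antitone f → ∃ n, ∀ m, n ≤ m → f m = f n) : MulDCC μ := by
  intro f hf hanti
  have hcomap : ∀ k, IsMulIdeal μ ((f k).comap σ) := by
    intro k n x hx
    rw [Submodule.mem_comap, hμ]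
    exact hf k _ _ hx
  have hcanti : Antitone fun k ↦ (f k).comap σ := fun i j hij ↦ Submodule.comap_mono (hanti hij)
  obtain ⟨n₁, h₁⟩ := h (fun k ↦ f k ⊓ (f k).comap σ)
    (fun k n x hx ↦ ⟨hf k n x hx.1, hcomap k n x hx.2⟩)
    (fun k x hx ↦ ⟨hx.2, by simpa [hσ] using hx.1⟩)
    (fun i j hij ↦ inf_le_inf (hanti hij) (hcanti hij))
  obtain ⟨n₂, h₂⟩ := h (fun k ↦ f k ⊔ (f k).comap σ)
    (fun k n x hx ↦ by
      obtain ⟨y, hy, z, hz, rfl⟩ := Submodule.mem_sup.1 hx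
      rw [map_add]
      exact Submodule.add_mem_sup (hf k n y hy) (hcomap k n z hz))
    (fun k x hx ↦ by
      obtain ⟨y, hy, z, hz, rfl⟩ := Submodule.mem_sup.1 hx
      rw [map_add, add_comm]
      exact Submodule.add_mem_sup hz (by simpa [hσ] using hy))
    (fun i j hij ↦ sup_le_sup (hanti hij) (hcanti hij))
  refine ⟨max n₁ n₂, fun m hm ↦ le_antisymm (hanti hm) ?_⟩
  set n := max n₁ n₂
  have hinf : f m ⊓ (f m).comap σ = f n ⊓ (f n).comap σ :=
    (h₁ m ((le_max_left _ _).trans hm)).trans (h₁ n (le_max_left _ _)).symm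
  have hsup : f m ⊔ (f m).comap σ = f n ⊔ (f n).comap σ :=
    (h₂ m ((le_max_right _ _).trans hm)).trans (h₂ n (le_max_right _ _)).symm
  calc f n ≤ (f m ⊔ (f m).comap σ) ⊓ f n := le_inf (hsup ▸ le_sup_left) le_rfl
    _ = f m ⊔ (f m).comap σ ⊓ f n := sup_inf_assoc_of_le _ (hanti hm)
    _ ≤ f m ⊔ f n ⊓ (f n).comap σ :=
      sup_le_sup_left (le_inf inf_le_right (inf_le_left.trans (hcanti hm))) _
    _ ≤ f m := by rw [← hinf]; exact sup_le le_rfl inf_le_left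

end Artinian

section Bernstein

variable {K A : Type*} [Field K] [NonUnitalNonAssocCommRing A] [Module K A] [SMulCommClass K A A]
  [IsScalarTower K A A]

/-- `A` is a Bernstein algebra with weight function `ω`, and `e` is an idempotent of weight `1`. -/
structure IsBernstein (ω : A →ₗ[K] K) (e : A) : Prop where
  two_ne_zero : (2 : K) ≠ 0
  three_ne_zero : (3 : K) ≠ 0
  map_mul : ∀ x y : A, ω (x * y) = ω x * ω y
  sq_sq : ∀ x : A, (x * x) * (x * x) = ω x ^ 2 • (x * x)
  idem : e * e = e
  weight : ω e = 1

theorem eq_zero_of_quartic {M : Type*} [AddCommGroup M] [Module K M] (h2 : (2 : K) ≠ 0)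
    (h3 : (3 : K) ≠ 0) {a b c d : M}
    (h : ∀ t : K, t • a + t ^ 2 • b + t ^ 3 • c + t ^ 4 • d = 0) :
    a = 0 ∧ b = 0 ∧ c = 0 ∧ d = 0 := by
  have h12 : (12 : K) ≠ 0 := by
    rw [show (12 : K) = 2 * 2 * 3 by norm_num]
    exact mul_ne_zero (mul_ne_zero h2 h2) h3
  have ha := h 1
  have hb := h (-1)
  have hc := h 2
  have hd := h (-2)
  have hc0 : c = 0 := by
    refine (smul_eq_zero_iff_right h12).1 ?_
    linear_combination (norm := module) hc - hd - (2 : K) • ha + (2 : K) • hb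
  have hd0 : d = 0 := by
    refine (smul_eq_zero_iff_right (mul_ne_zero h12 h2)).1 ?_
    linear_combination (norm := module) hc + hd - (4 : K) • ha - (4 : K) • hb
  subst hc0 hd0
  refine ⟨(smul_eq_zero_iff_right h2).1 ?_, (smul_eq_zero_iff_right h2).1 ?_, rfl, rfl⟩
  · linear_combination (norm := module) ha - hb
  · linear_combination (norm := module) ha + hb

namespace IsBernstein

variable {ω : A →ₗ[K] K} {e : A}

theorem ker_identities (h : IsBernstein ω e) {y : A} (hy : ω y = 0) :
    (4 : K) • (e * (e * y)) - (2 : K) • (e * y) = 0 ∧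
      (2 : K) • (e * (y * y)) + (4 : K) • (e * y * (e * y)) - y * y = 0 ∧
        (4 : K) • (e * y * (y * y)) = 0 ∧ y * y * (y * y) = 0 := by
  refine eq_zero_of_quartic h.two_ne_zero h.three_ne_zero fun t ↦ ?_
  have := h.sq_sq (e + t • y)
  have hw : ω (e + t • y) = 1 := by simp [hy, h.weight]
  rw [hw] at this
  have hsq : (e + t • y) * (e + t • y) = e + (2 * t) • (e * y) + t ^ 2 • (y * y) := by
    simp only [mul_add, add_mul, smul_mul_assoc, mul_smul_comm, h.idem, mul_comm y e]
    module
  rw [hsq] at this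
  simp only [mul_add, add_mul, smul_mul_assoc, mul_smul_comm, h.idem, mul_comm _ e,
    mul_comm (y * y) (e * y)] at this
  linear_combination (norm := module) this

theorem weight_of_mem_peirceU (h : IsBernstein ω e) {u : A} (hu : u ∈ peirceU K e) : ω u = 0 := by
  have h1 : ω (e * u) = ω ((2 : K)⁻¹ • u) := congrArg ω hu
  rw [h.map_mul, h.weight, map_smul, smul_eq_mul] at h1
  have := h.two_ne_zero
  field_simp at h1
  linear_combination h1

theorem weight_of_mem_peirceV (h : IsBernstein ω e) {v : A} (hv : v ∈ peirceV K e) : ω v = 0 := by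
  have h1 : ω (e * v) = ω 0 := congrArg ω hv
  simpa [h.map_mul, h.weight] using h1

theorem mem_peirceU_iff (h : IsBernstein ω e) {u : A} :
    u ∈ peirceU K e ↔ (2 : K) • (e * u) = u := by
  change e * u = (2 : K)⁻¹ • u ↔ _
  rw [eq_inv_smul_iff₀ h.two_ne_zero]

theorem mul_self_mem_peirceV (h : IsBernstein ω e) {u : A} (hu : u ∈ peirceU K e) :
    u * u ∈ peirceV K e := by
  have h1 := (h.ker_identities (h.weight_of_mem_peirceU hu)).2.1
  rw [show e * u = (2 : K)⁻¹ • u from hu] at h1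
  have := h.two_ne_zero
  refine (smul_eq_zero_iff_right this).1 ?_
  rw [smul_mul_smul_comm] at h1
  rw [← h1]
  match_scalars
  · field_simp
  · field_simp
    norm_num

theorem mul_mem_peirceV (h : IsBernstein ω e) {x y : A} (hx : x ∈ peirceU K e)
    (hy : y ∈ peirceU K e) : x * y ∈ peirceV K e := by
  have h1 := sub_mem (sub_mem (h.mul_self_mem_peirceV (add_mem hx hy))
    (h.mul_self_mem_peirceV hx)) (h.mul_self_mem_peirceV hy)
  rw [← Submodule.smul_mem_iff _ h.two_ne_zero]
  convert h1 using 1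
  rw [add_mul, mul_add, mul_add, mul_comm y x]
  module

theorem mul_self_mem_peirceU (h : IsBernstein ω e) {v : A} (hv : v ∈ peirceV K e) :
    v * v ∈ peirceU K e := by
  have h1 := (h.ker_identities (h.weight_of_mem_peirceV hv)).2.1
  rw [show e * v = 0 from hv] at h1
  rw [h.mem_peirceU_iff]
  simpa [sub_eq_zero] using h1

theorem mul_mem_peirceU_of_peirceV (h : IsBernstein ω e) {x y : A} (hx : x ∈ peirceV K e)
    (hy : y ∈ peirceV K e) : x * y ∈ peirceU K e := by
  have h1 := sub_mem (sub_mem (h.mul_self_mem_peirceU (add_mem hx hy))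
    (h.mul_self_mem_peirceU hx)) (h.mul_self_mem_peirceU hy)
  rw [← Submodule.smul_mem_iff _ h.two_ne_zero]
  convert h1 using 1
  rw [add_mul, mul_add, mul_add, mul_comm y x]
  module

theorem mul_mem_peirceU (h : IsBernstein ω e) {v u : A} (hv : v ∈ peirceV K e)
    (hu : u ∈ peirceU K e) : v * u ∈ peirceU K e := by
  have h1 := (h.ker_identities (y := u + v)
    (by rw [map_add, h.weight_of_mem_peirceU hu, h.weight_of_mem_peirceV hv, add_zero])).2.1
  have h2 := h.two_ne_zero
  have hu2 : e * (u * u) = 0 := h.mul_self_mem_peirceV hu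
  have hv2 := h.mem_peirceU_iff.1 (h.mul_self_mem_peirceU hv)
  have hev : e * v = 0 := hv
  have heu : (2 : K) • (e * u) = u := h.mem_peirceU_iff.1 hu
  rw [h.mem_peirceU_iff]
  rw [mul_add e u v, hev, add_zero, show (4 : K) • (e * u * (e * u)) = u * u by
    conv_rhs => rw [← heu]
    rw [smul_mul_smul_comm]; norm_num] at h1
  simp only [mul_add, add_mul, mul_comm u v, hu2] at h1
  refine (smul_right_injective A h2) ?_
  change (2 : K) • (2 : K) • (e * (v * u)) = (2 : K) • (v * u)
  linear_combination (norm := module) h1 - hv2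

theorem cubic (h : IsBernstein ω e) {u v : A} (hu : u ∈ peirceU K e) (hv : v ∈ peirceV K e) :
    u * (u * u) = 0 ∧ u * (v * u) = 0 ∧ u * (v * v) = 0 := by
  have h2 := h.two_ne_zero
  have key : ∀ w ∈ peirceV K e, u * ((u + w) * (u + w)) = 0 := by
    intro w hw
    have h1 := (h.ker_identities (y := u + w)
      (by rw [map_add, h.weight_of_mem_peirceU hu, h.weight_of_mem_peirceV hw, add_zero])).2.2.1
    rw [mul_add e u w, show e * w = 0 from hw, add_zero, show e * u = (2 : K)⁻¹ • u from hu,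
      smul_mul_assoc, smul_smul, smul_eq_zero_iff_right] at h1
    · exact h1
    · exact mul_ne_zero (by rw [show (4 : K) = 2 * 2 by norm_num]; exact mul_ne_zero h2 h2)
        (inv_ne_zero h2)
  have h0 := key 0 (zero_mem _)
  rw [add_zero] at h0
  have h1 := key v hv
  have h1' := key (-v) (neg_mem hv)
  simp only [mul_add, add_mul, mul_neg, neg_mul, mul_comm u v, h0] at h1 h1'
  refine ⟨h0, (smul_eq_zero_iff_right (mul_ne_zero h2 h2)).1 ?_,
    (smul_eq_zero_iff_right h2).1 ?_⟩
  · linear_combination (norm := module) h1 - h1'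
  · linear_combination (norm := module) h1 + h1'

theorem disjoint_peirce (h : IsBernstein ω e) : Disjoint (peirceU K e) (peirceV K e) := by
  rw [Submodule.disjoint_def]
  intro x hu hv
  rw [← h.mem_peirceU_iff.1 hu, show e * x = 0 from hv, smul_zero]

theorem mul_mul_self (h : IsBernstein ω e) {u v : A} (hu : u ∈ peirceU K e)
    (hv : v ∈ peirceV K e) : v * u * (v * u) = 0 := by
  have h2 := h.two_ne_zero
  have key : ∀ w ∈ peirceV K e, (u + w) * (u + w) * ((u + w) * (u + w)) = 0 := by
    intro w hw
    exact (h.ker_identities (y := u + w)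
      (by rw [map_add, h.weight_of_mem_peirceU hu, h.weight_of_mem_peirceV hw, add_zero])).2.2.2
  have h0 := key 0 (zero_mem _)
  rw [add_zero] at h0
  have h0' := (h.ker_identities (h.weight_of_mem_peirceV hv)).2.2.2
  have h1 := key v hv
  have h1' := key (-v) (neg_mem hv)
  have hsq : (u + v) * (u + v) = u * u + (2 : K) • (v * u) + v * v := by
    simp only [mul_add, add_mul, mul_comm u v]
    module
  have hsq' : (u + -v) * (u + -v) = u * u - (2 : K) • (v * u) + v * v := by
    simp only [mul_add, add_mul, mul_comm u v, mul_neg, neg_mul]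
    module
  rw [hsq] at h1
  rw [hsq'] at h1'
  simp only [mul_add, add_mul, mul_sub, sub_mul, smul_mul_assoc, mul_smul_comm, h0, h0',
    mul_comm (v * u) (u * u), mul_comm (v * v)] at h1 h1'
  have hU : u * u * (v * v) ∈ peirceU K e :=
    h.mul_mem_peirceU (h.mul_self_mem_peirceV hu) (h.mul_self_mem_peirceU hv)
  have hV : v * u * (v * u) ∈ peirceV K e := h.mul_self_mem_peirceV (h.mul_mem_peirceU hv hu)
  have hsum : (2 : K) • (v * u * (v * u)) = -(u * u * (v * v)) := by
    refine smul_right_injective A (mul_ne_zero h2 h2) ?_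
    change (2 * 2 : K) • (2 : K) • (v * u * (v * u)) = (2 * 2 : K) • -(u * u * (v * v))
    linear_combination (norm := module) h1 + h1'
  refine (smul_eq_zero_iff_right h2).1 (Submodule.disjoint_def.1 h.disjoint_peirce _ ?_ ?_)
  · rw [hsum]; exact neg_mem hU
  · exact Submodule.smul_mem _ _ hV

theorem mul_mul_comm_neg (h : IsBernstein ω e) {x y v : A} (hx : x ∈ peirceU K e)
    (hy : y ∈ peirceU K e) (hv : v ∈ peirceV K e) : x * (v * y) = -(y * (v * x)) := by
  have h1 := (h.cubic (add_mem hx hy) hv).2.1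
  simp only [mul_add, add_mul, (h.cubic hx hv).2.1, (h.cubic hy hv).2.1] at h1
  linear_combination (norm := module) h1

theorem mul_mul_eq_zero (h : IsBernstein ω e) {u v w : A} (hu : u ∈ peirceU K e)
    (hv : v ∈ peirceV K e) (hw : w ∈ peirceV K e) : u * (v * w) = 0 := by
  have h1 := (h.cubic hu (add_mem hv hw)).2.2
  simp only [mul_add, add_mul, (h.cubic hu hv).2.2, (h.cubic hu hw).2.2, mul_comm w v] at h1
  refine (smul_eq_zero_iff_right h.two_ne_zero).1 ?_
  linear_combination (norm := module) h1

theorem mul_mul_mul_eq_zero (h : IsBernstein ω e) {x y v : A} (hx : x ∈ peirceU K e)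
    (hy : y ∈ peirceU K e) (hv : v ∈ peirceV K e) : v * x * (v * y) = 0 := by
  have h1 := h.mul_mul_self (add_mem hx hy) hv
  simp only [mul_add, add_mul, h.mul_mul_self hx hv, h.mul_mul_self hy hv,
    mul_comm (v * y) (v * x)] at h1
  refine (smul_eq_zero_iff_right h.two_ne_zero).1 ?_
  linear_combination (norm := module) h1

theorem jacobi (h : IsBernstein ω e) {x y z : A} (hx : x ∈ peirceU K e)
    (hy : y ∈ peirceU K e) (hz : z ∈ peirceU K e) :
    x * y * z + y * z * x + z * x * y = 0 := by
  have hc : ∀ u ∈ peirceU K e, u * (u * u) = 0 := fun u hu ↦ (h.cubic hu (zero_mem _)).1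
  have key : ∀ w ∈ peirceU K e, (2 : K) • (w * (x * w)) + x * (w * w) = 0 := by
    intro w hw
    have h1 := hc _ (add_mem hx hw)
    have h2 := hc _ (sub_mem hx hw)
    simp only [mul_add, add_mul, mul_sub, sub_mul, hc x hx, hc w hw, mul_comm w x] at h1 h2
    refine (smul_eq_zero_iff_right h.two_ne_zero).1 ?_
    linear_combination (norm := module) h1 + h2
  have h1 := key _ (add_mem hy hz)
  simp only [mul_add, add_mul, mul_comm z y] at h1
  rw [mul_comm (x * y), mul_comm (y * z), mul_comm (z * x), mul_comm z x]
  refine (smul_eq_zero_iff_right h.two_ne_zero).1 ?_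
  linear_combination (norm := module) h1 - key y hy - key z hz

theorem exists_peirce_add (h : IsBernstein ω e) {y : A} (hy : ω y = 0) :
    ∃ u ∈ peirceU K e, ∃ v ∈ peirceV K e, u + v = y := by
  have h1 : (2 : K) • (e * (e * y)) = e * y := by
    refine smul_right_injective A h.two_ne_zero ?_
    change (2 : K) • (2 : K) • (e * (e * y)) = (2 : K) • (e * y)
    linear_combination (norm := module) (h.ker_identities hy).1
  refine ⟨(2 : K) • (e * y), ?_, y - (2 : K) • (e * y), ?_, add_sub_cancel _ _⟩
  · rw [h.mem_peirceU_iff, mul_smul_comm, h1]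
  · change e * (y - (2 : K) • (e * y)) = 0
    rw [mul_sub, mul_smul_comm, h1, sub_self]

theorem exists_decomp (h : IsBernstein ω e) (a : A) :
    ∃ c : K, ∃ u ∈ peirceU K e, ∃ v ∈ peirceV K e, a = c • e + u + v := by
  obtain ⟨u, hu, v, hv, huv⟩ := h.exists_peirce_add (y := a - ω a • e) (by simp [h.weight])
  exact ⟨ω a, u, hu, v, hv, by rw [add_assoc, huv, add_sub_cancel]⟩

/-- The elements of `U` annihilated by `U`. -/
def annU (K : Type*) {A : Type*} [Field K] [NonUnitalNonAssocCommRing A] [Module K A]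
    [SMulCommClass K A A] [IsScalarTower K A A] (e : A) : Submodule K A where
  carrier := {u | u ∈ peirceU K e ∧ ∀ x ∈ peirceU K e, x * u = 0}
  add_mem' ha hb := ⟨add_mem ha.1 hb.1, fun x hx ↦ by rw [mul_add, ha.2 x hx, hb.2 x hx, add_zero]⟩
  zero_mem' := ⟨zero_mem _, fun x _ ↦ mul_zero x⟩
  smul_mem' c a ha := ⟨Submodule.smul_mem _ c ha.1, fun x hx ↦ by
    rw [mul_smul_comm, ha.2 x hx, smul_zero]⟩

theorem mul_mem_annU (h : IsBernstein ω e) {v w : A} (hv : v ∈ peirceV K e)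
    (hw : w ∈ peirceV K e) : v * w ∈ annU K e :=
  ⟨h.mul_mem_peirceU_of_peirceV hv hw, fun _ hx ↦ h.mul_mul_eq_zero hx hv hw⟩

theorem mul_mem_annU_of_mem (h : IsBernstein ω e) {v u : A} (hv : v ∈ peirceV K e)
    (hu : u ∈ annU K e) : v * u ∈ annU K e := by
  refine ⟨h.mul_mem_peirceU hv hu.1, fun x hx ↦ ?_⟩
  rw [h.mul_mul_comm_neg hx hu.1 hv, mul_comm, hu.2 _ (h.mul_mem_peirceU hv hx), neg_zero]

theorem mul_mul_mem_annU (h : IsBernstein ω e) {v u : A} (hv : v ∈ peirceV K e)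
    (hu : u ∈ peirceU K e) : v * (v * u) ∈ annU K e := by
  have hvu := h.mul_mem_peirceU hv hu
  refine ⟨h.mul_mem_peirceU hv hvu, fun x hx ↦ ?_⟩
  rw [h.mul_mul_comm_neg hx hvu hv, h.mul_mul_mul_eq_zero hu hx hv, neg_zero]

theorem mul_mul_add_mem_annU (h : IsBernstein ω e) {v w u : A} (hv : v ∈ peirceV K e)
    (hw : w ∈ peirceV K e) (hu : u ∈ peirceU K e) : v * (w * u) + w * (v * u) ∈ annU K e := by
  have h1 := sub_mem (sub_mem (h.mul_mul_mem_annU (add_mem hv hw) hu) (h.mul_mul_mem_annU hv hu))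
    (h.mul_mul_mem_annU hw hu)
  convert h1 using 1
  simp only [add_mul, mul_add]
  module

/-- `U` modulo the elements annihilated by `U`. -/
abbrev QuotU (K : Type*) {A : Type*} [Field K] [NonUnitalNonAssocCommRing A] [Module K A]
    [SMulCommClass K A A] [IsScalarTower K A A] (e : A) : Type _ :=
  ↥(peirceU K e) ⧸ (annU K e).submoduleOf (peirceU K e)

theorem mk_eq_zero_iff {u : A} (hu : u ∈ peirceU K e) :
    (Submodule.Quotient.mk ⟨u, hu⟩ : QuotU K e) = 0 ↔ u ∈ annU K e := by
  rw [Submodule.Quotient.mk_eq_zero]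
  rfl

/-- A Bernstein algebra gives rise to a Bernstein pair. -/
theorem exists_pair (h : IsBernstein ω e) :
    ∃ (b : QuotU K e →ₗ[K] QuotU K e →ₗ[K] peirceV K e)
      (m : peirceV K e →ₗ[K] Module.End K (QuotU K e)),
      (∀ x y : peirceU K e, (b (Submodule.Quotient.mk x) (Submodule.Quotient.mk y) : A) = x * y) ∧
      (∀ (v : peirceV K e) (x : peirceU K e), m v (Submodule.Quotient.mk x) =
        Submodule.Quotient.mk ⟨v * x, h.mul_mem_peirceU v.2 x.2⟩) := by
  let b₀ : peirceU K e →ₗ[K] peirceU K e →ₗ[K] peirceV K e :=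
    LinearMap.mk₂ K (fun x y ↦ ⟨x * y, h.mul_mem_peirceV x.2 y.2⟩)
      (fun _ _ _ ↦ Subtype.ext (add_mul _ _ _)) (fun _ _ _ ↦ Subtype.ext (smul_mul_assoc _ _ _))
      (fun _ _ _ ↦ Subtype.ext (mul_add _ _ _)) (fun _ _ _ ↦ Subtype.ext (mul_smul_comm _ _ _))
  let m₀ : peirceU K e →ₗ[K] peirceV K e →ₗ[K] peirceU K e :=
    LinearMap.mk₂ K (fun x v ↦ ⟨v * x, h.mul_mem_peirceU v.2 x.2⟩)
      (fun _ _ _ ↦ Subtype.ext (mul_add _ _ _)) (fun _ _ _ ↦ Subtype.ext (mul_smul_comm _ _ _))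
      (fun _ _ _ ↦ Subtype.ext (add_mul _ _ _)) (fun _ _ _ ↦ Subtype.ext (smul_mul_assoc _ _ _))
  set p := (annU K e).submoduleOf (peirceU K e)
  have hb₁ : p ≤ LinearMap.ker b₀ := by
    intro x hx
    refine LinearMap.mem_ker.2 (LinearMap.ext fun y ↦ Subtype.ext ?_)
    exact (mul_comm _ _).trans (hx.2 y y.2)
  have hb₂ : p ≤ LinearMap.ker (p.liftQ b₀ hb₁).flip := by
    intro y hy
    refine LinearMap.mem_ker.2 (LinearMap.ext fun x ↦ ?_)
    obtain ⟨x, rfl⟩ := Submodule.Quotient.mk_surjective _ x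
    exact Subtype.ext (hy.2 x x.2)
  have hm : p ≤ LinearMap.ker (m₀.compr₂ p.mkQ) := by
    intro x hx
    refine LinearMap.mem_ker.2 (LinearMap.ext fun v ↦ ?_)
    exact (mk_eq_zero_iff _).2 (h.mul_mem_annU_of_mem v.2 hx)
  exact ⟨(p.liftQ (p.liftQ b₀ hb₁).flip hb₂).flip, (p.liftQ (m₀.compr₂ p.mkQ) hm).flip,
    fun _ _ ↦ rfl, fun _ _ ↦ rfl⟩

section Pair

variable {b : QuotU K e →ₗ[K] QuotU K e →ₗ[K] peirceV K e}
  {m : peirceV K e →ₗ[K] Module.End K (QuotU K e)} (h : IsBernstein ω e)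
  (hb : ∀ x y : peirceU K e,
    (b (Submodule.Quotient.mk x) (Submodule.Quotient.mk y) : A) = x * y)
  (hm : ∀ (v : peirceV K e) (x : peirceU K e), m v (Submodule.Quotient.mk x) =
    Submodule.Quotient.mk ⟨v * x, h.mul_mem_peirceU v.2 x.2⟩)

include hb hm

theorem isBernsteinPair : IsBernsteinPair b m where
  comm x y := by
    obtain ⟨x, rfl⟩ := Submodule.Quotient.mk_surjective _ x
    obtain ⟨y, rfl⟩ := Submodule.Quotient.mk_surjective _ y
    exact Subtype.ext (by rw [hb, hb, mul_comm])
  anti v w := by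
    refine LinearMap.ext fun x ↦ ?_
    obtain ⟨x, rfl⟩ := Submodule.Quotient.mk_surjective _ x
    rw [LinearMap.neg_apply, eq_neg_iff_add_eq_zero, Module.End.mul_apply, Module.End.mul_apply,
      hm, hm, hm, hm, ← Submodule.Quotient.mk_add]
    exact (mk_eq_zero_iff _).2 (h.mul_mul_add_mem_annU v.2 w.2 x.2)
  skew x v y := by
    obtain ⟨x, rfl⟩ := Submodule.Quotient.mk_surjective _ x
    obtain ⟨y, rfl⟩ := Submodule.Quotient.mk_surjective _ y
    refine Subtype.ext ?_
    rw [hm, hm, hb, Submodule.coe_neg, hb]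
    exact h.mul_mul_comm_neg x.2 y.2 v.2
  jacobi x y z := by
    obtain ⟨x, rfl⟩ := Submodule.Quotient.mk_surjective _ x
    obtain ⟨y, rfl⟩ := Submodule.Quotient.mk_surjective _ y
    obtain ⟨z, rfl⟩ := Submodule.Quotient.mk_surjective _ z
    rw [hm, hm, hm, ← Submodule.Quotient.mk_add, ← Submodule.Quotient.mk_add]
    refine (mk_eq_zero_iff _).2 ?_
    simp only [hb, Submodule.coe_add]
    rw [h.jacobi x.2 y.2 z.2]
    exact zero_mem _

omit hb hm

/-- The subspace of `U ⊕ V` corresponding to a subspace of the pair. -/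
def lift (X : Submodule K (QuotU K e × peirceV K e)) : Submodule K A :=
  (X.comap (LinearMap.prodMap (Submodule.mkQ _) LinearMap.id)).map
    ((peirceU K e).subtype.coprod (peirceV K e).subtype)

theorem mem_lift {X : Submodule K (QuotU K e × peirceV K e)} {a : A} :
    a ∈ lift X ↔ ∃ (u : peirceU K e) (v : peirceV K e),
      (Submodule.Quotient.mk u, v) ∈ X ∧ (u : A) + v = a := by
  simp only [lift, Submodule.mem_map, Submodule.mem_comap, Prod.exists]
  rfl

theorem lift_mono {X Y : Submodule K (QuotU K e × peirceV K e)} (hXY : X ≤ Y) :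
    lift X ≤ lift Y :=
  Submodule.map_mono (Submodule.comap_mono hXY)

include h in
theorem le_of_lift_le {X Y : Submodule K (QuotU K e × peirceV K e)} (hXY : lift X ≤ lift Y) :
    X ≤ Y := by
  rintro ⟨x, v⟩ hx
  obtain ⟨u, rfl⟩ := Submodule.Quotient.mk_surjective _ x
  obtain ⟨u', v', hmem, heq⟩ := mem_lift.1 (hXY (mem_lift.2 ⟨u, v, hx, rfl⟩))
  have h1 : (u' : A) - u = v - v' := by rw [sub_eq_sub_iff_add_eq_add, heq, add_comm]
  have h2 : (u' : A) - u = 0 := Submodule.disjoint_def.1 h.disjoint_peirce _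
    (sub_mem u'.2 u.2) (h1 ▸ sub_mem v.2 v'.2)
  have h3 : u' = u := Subtype.ext (sub_eq_zero.1 h2)
  have h4 : v' = v := Subtype.ext (sub_eq_zero.1 (h1.symm.trans h2)).symm
  rwa [h3, h4] at hmem

theorem sup_le_lift_top : peirceU K e ⊔ peirceV K e ≤
    lift (⊤ : Submodule K (QuotU K e × peirceV K e)) := by
  intro a ha
  obtain ⟨u, hu, v, hv, rfl⟩ := Submodule.mem_sup.1 ha
  exact mem_lift.2 ⟨⟨u, hu⟩, ⟨v, hv⟩, trivial, rfl⟩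

theorem lift_bot_le : lift (⊥ : Submodule K (QuotU K e × peirceV K e)) ≤ annU K e := by
  intro a ha
  obtain ⟨u, v, hmem, rfl⟩ := mem_lift.1 ha
  rw [Submodule.mem_bot, Prod.mk_eq_zero] at hmem
  rw [hmem.2, Submodule.coe_zero, add_zero]
  exact (mk_eq_zero_iff u.2).1 hmem.1

include h hb hm

theorem mul_mem_lift {X : Submodule K (QuotU K e × peirceV K e)} {u v a : A}
    (hu : u ∈ peirceU K e) (hv : v ∈ peirceV K e) (ha : a ∈ lift X) :
    (u + v) * a ∈ lift (Submodule.map₂ (pairMul b m) ⊤ X) := by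
  obtain ⟨x, w, hmem, rfl⟩ := mem_lift.1 ha
  refine mem_lift.2 ⟨⟨v * x + w * u + v * w, add_mem (add_mem (h.mul_mem_peirceU hv x.2)
    (h.mul_mem_peirceU w.2 hu)) (h.mul_mem_peirceU_of_peirceV hv w.2)⟩,
    ⟨u * x, h.mul_mem_peirceV hu x.2⟩, ?_, ?_⟩
  · have := Submodule.apply_mem_map₂ (pairMul b m) (m := (Submodule.Quotient.mk ⟨u, hu⟩, ⟨v, hv⟩))
      (p := ⊤) trivial hmem
    rw [pairMul_apply] at this
    convert this using 1
    refine Prod.ext ?_ (Subtype.ext (hb ⟨u, hu⟩ x).symm)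
    rw [hm, hm, ← Submodule.Quotient.mk_add, eq_comm, ← sub_eq_zero, ← Submodule.Quotient.mk_sub]
    refine (mk_eq_zero_iff _).2 ?_
    convert neg_mem (h.mul_mem_annU hv w.2) using 1
    simp
  · simp only [mul_add, add_mul, mul_comm u w.1]
    abel

theorem subMul_lift_le (X : Submodule K (QuotU K e × peirceV K e)) :
    subMul (peirceU K e ⊔ peirceV K e) (lift X) ≤ lift (Submodule.map₂ (pairMul b m) ⊤ X) := by
  refine Submodule.map₂_le.2 fun n hn a ha ↦ ?_
  obtain ⟨u, hu, v, hv, rfl⟩ := Submodule.mem_sup.1 hn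
  exact h.mul_mem_lift hb hm hu hv ha

theorem mulDCC (hart : ∀ f : ℕ → Submodule K A, (∀ k, ∀ a : A, ∀ x ∈ f k, a * x ∈ f k) →
    Antitone f → ∃ n, ∀ m, n ≤ m → f m = f n) : MulDCC (pairMul b m) := by
  refine MulDCC.of_involution
    (σ := LinearMap.prodMap (-LinearMap.id) LinearMap.id) (by simp) (fun x y ↦ ?_) ?_
  · simp [pairMul_apply, add_comm]
  intro f hf hσ hanti
  have key (k : ℕ) (a x : A) (hx : x ∈ lift (f k)) : a * x ∈ lift (f k) := by
    obtain ⟨c, u, hu, v, hv, rfl⟩ := h.exists_decomp a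
    rw [add_assoc, add_mul]
    refine add_mem ?_ (lift_mono (isMulIdeal_iff.1 (hf k)) (h.mul_mem_lift hb hm hu hv hx))
    obtain ⟨y, w, hmem, rfl⟩ := mem_lift.1 hx
    rw [smul_mul_assoc]
    refine Submodule.smul_mem _ c (mem_lift.2 ⟨(2 : K)⁻¹ • y, 0, ?_, ?_⟩)
    · have h1 := Submodule.smul_mem _ (2 : K)⁻¹ (sub_mem hmem (hσ k _ hmem))
      have h2 := Submodule.smul_mem _ (2 : K)⁻¹ h1
      convert h2 using 1
      have := h.two_ne_zero
      refine Prod.ext ?_ (by simp)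
      simp only [Submodule.Quotient.mk_smul, Prod.smul_fst, Prod.fst_sub, LinearMap.prodMap_apply,
        LinearMap.neg_apply, LinearMap.id_apply]
      match_scalars
      field_simp
      norm_num
    · rw [mul_add, show e * (w : A) = 0 from w.2, show e * (y : A) = (2 : K)⁻¹ • y from y.2]
      simp
  obtain ⟨n, hn⟩ := hart (fun k ↦ lift (f k)) key fun i j hij ↦ lift_mono (hanti hij)
  exact ⟨n, fun k hk ↦ le_antisymm (h.le_of_lift_le (hn k hk).le) (h.le_of_lift_le (hn k hk).ge)⟩

end Pair

theorem exists_chain (h : IsBernstein ω e) (hart : ∀ f : ℕ → Submodule K A,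
    (∀ k, ∀ a : A, ∀ x ∈ f k, a * x ∈ f k) → Antitone f → ∃ n, ∀ m, n ≤ m → f m = f n) :
    ∃ (n : ℕ) (J : ℕ → Submodule K A), peirceU K e ⊔ peirceV K e ≤ J 0 ∧ J n ≤ annU K e ∧
      ∀ k, subMul (peirceU K e ⊔ peirceV K e) (J k) ≤ J (k + 1) := by
  obtain ⟨b, m, hb, hm⟩ := h.exists_pair
  have hbm := h.isBernsteinPair hb hm
  have hln : LocallyNilpotent (pairMul b m) := fun S hS ↦
    hbm.exists_iterate_pairMul_eq_bot h.two_ne_zero hS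
  obtain ⟨n, hn⟩ := hln.exists_iterate_top_eq_bot (h.mulDCC hb hm hart) (pairMul_comm hbm)
    (pairMul_jacobi hbm)
  refine ⟨n, fun k ↦ lift ((Submodule.map₂ (pairMul b m) ⊤)^[k] ⊤), sup_le_lift_top, ?_, ?_⟩
  · simp only [hn]
    exact lift_bot_le
  · intro k
    simp only [Function.iterate_succ_apply']
    exact h.subMul_lift_le hb hm _

theorem mul_mem_sup (h : IsBernstein ω e) {x y : A} (hx : x ∈ peirceU K e ⊔ peirceV K e)
    (hy : y ∈ peirceU K e ⊔ peirceV K e) : x * y ∈ peirceU K e ⊔ peirceV K e := by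
  obtain ⟨u, hu, v, hv, rfl⟩ := Submodule.mem_sup.1 hx
  obtain ⟨u', hu', v', hv', rfl⟩ := Submodule.mem_sup.1 hy
  rw [add_mul, mul_add, mul_add, mul_comm u v']
  exact add_mem
    (add_mem (Submodule.mem_sup_right (h.mul_mem_peirceV hu hu'))
      (Submodule.mem_sup_left (h.mul_mem_peirceU hv' hu)))
    (add_mem (Submodule.mem_sup_left (h.mul_mem_peirceU hv hu'))
      (Submodule.mem_sup_left (h.mul_mem_peirceU_of_peirceV hv hv')))

theorem subMul_annU_le {X : Submodule K A} (hX : X ≤ annU K e) :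
    subMul (peirceU K e ⊔ peirceV K e) X ≤ subMul (peirceV K e) X := by
  refine Submodule.map₂_le.2 fun n hn x hx ↦ ?_
  obtain ⟨u, hu, v, hv, rfl⟩ := Submodule.mem_sup.1 hn
  rw [LinearMap.mul_apply', add_mul, (hX hx).2 u hu, zero_add]
  exact Submodule.apply_mem_map₂ _ hv hx

theorem iterate_annU (h : IsBernstein ω e) (j : ℕ) :
    (subMul (peirceV K e))^[j] (annU K e) ≤ annU K e ∧
      subMul (peirceV K e) ((subMul (peirceV K e))^[j] (annU K e)) ≤
        (subMul (peirceV K e))^[j] (annU K e) := by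
  have h0 : subMul (peirceV K e) (annU K e) ≤ annU K e :=
    Submodule.map₂_le.2 fun v hv u hu ↦ h.mul_mem_annU_of_mem hv hu
  induction j with
  | zero => exact ⟨le_rfl, h0⟩
  | succ j ih =>
    rw [Function.iterate_succ_apply']
    exact ⟨ih.2.trans ih.1, Submodule.map₂_le_map₂_right ih.2⟩

theorem exists_iterate_annU_eq_bot (h : IsBernstein ω e) (hart : ∀ f : ℕ → Submodule K A,
    (∀ k, ∀ a : A, ∀ x ∈ f k, a * x ∈ f k) → Antitone f → ∃ n, ∀ m, n ≤ m → f m = f n)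
    (hV : ∀ I : Submodule K A, subMul (peirceV K e) I = I → I = ⊥) :
    ∃ j, (subMul (peirceV K e))^[j] (annU K e) = ⊥ := by
  have key (j : ℕ) (a x : A) (hx : x ∈ (subMul (peirceV K e))^[j] (annU K e)) :
      a * x ∈ (subMul (peirceV K e))^[j] (annU K e) := by
    have hxU := (h.iterate_annU j).1 hx
    obtain ⟨c, u, hu, v, hv, rfl⟩ := h.exists_decomp a
    rw [add_mul, add_mul, hxU.2 u hu, add_zero, smul_mul_assoc,
      show e * x = (2 : K)⁻¹ • x from hxU.1]
    exact add_mem (Submodule.smul_mem _ _ (Submodule.smul_mem _ _ hx))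
      ((h.iterate_annU j).2 (Submodule.apply_mem_map₂ _ hv hx))
  obtain ⟨n, hn⟩ := hart (fun j ↦ (subMul (peirceV K e))^[j] (annU K e)) key
    (antitone_nat_of_succ_le fun j ↦ by
      rw [Function.iterate_succ_apply']
      exact (h.iterate_annU j).2)
  refine ⟨n, hV _ ?_⟩
  simpa only [Function.iterate_succ_apply'] using hn (n + 1) n.le_succ

end IsBernstein

section Powers

theorem subMul_comm (M N : Submodule K A) : subMul M N = subMul N M := by
  have key : ∀ M N : Submodule K A, subMul M N ≤ subMul N M := fun M N ↦
    Submodule.map₂_le.2 fun x hx y hy ↦ by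
      rw [LinearMap.mul_apply', mul_comm]
      exact Submodule.apply_mem_map₂ _ hy hx
  exact le_antisymm (key M N) (key N M)

theorem algPow_le {N : Submodule K A} (hN : subMul N N ≤ N) (n : ℕ) : algPow N n ≤ N := by
  induction n using Nat.strong_induction_on with
  | _ n ih =>
    match n with
    | 0 => rw [algPow]
    | 1 => rw [algPow]
    | n + 2 =>
      rw [algPow]
      refine iSup_le fun r ↦ (Submodule.map₂_le_map₂ (ih _ ?_) (ih _ ?_)).trans hN <;> omega

/-- If all sufficiently high powers of `N` lie in `X`, then all sufficiently high powers lie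
in `N X`. -/
theorem exists_algPow_le_subMul {N X : Submodule K A} (hN : subMul N N ≤ N)
    (hX : ∃ n, 1 ≤ n ∧ ∀ m, n ≤ m → algPow N m ≤ X) :
    ∃ n, 1 ≤ n ∧ ∀ m, n ≤ m → algPow N m ≤ subMul N X := by
  obtain ⟨n, hn, h⟩ := hX
  refine ⟨2 * n, by omega, fun m hm ↦ ?_⟩
  obtain ⟨m, rfl⟩ : ∃ k, m = k + 2 := ⟨m - 2, by omega⟩
  rw [algPow]
  refine iSup_le fun r ↦ ?_
  by_cases hr : n ≤ r + 1
  · rw [subMul_comm]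
    exact Submodule.map₂_le_map₂ (algPow_le hN _) (h _ hr)
  · exact Submodule.map₂_le_map₂ (algPow_le hN _) (h _ (by omega))

theorem iterate_subMul_le_algPow (N : Submodule K A) (n : ℕ) :
    (subMul N)^[n] N ≤ algPow N (n + 1) := by
  induction n with
  | zero => simp [algPow]
  | succ n ih =>
    rw [Function.iterate_succ_apply', algPow]
    refine le_iSup_of_le 0 (Submodule.map₂_le_map₂ ?_ ih)
    simp [algPow]

end Powers

namespace IsBernstein

variable {ω : A →ₗ[K] K} {e : A}

theorem algPow_eq_bot (h : IsBernstein ω e) (hart : ∀ f : ℕ → Submodule K A,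
    (∀ k, ∀ a : A, ∀ x ∈ f k, a * x ∈ f k) → Antitone f → ∃ n, ∀ m, n ≤ m → f m = f n)
    (hV : ∀ I : Submodule K A, subMul (peirceV K e) I = I → I = ⊥) :
    ∃ n, 1 ≤ n ∧ algPow (peirceU K e ⊔ peirceV K e) n = ⊥ := by
  obtain ⟨n, J, hJ0, hJn, hJ⟩ := h.exists_chain hart
  obtain ⟨j, hj⟩ := h.exists_iterate_annU_eq_bot hart hV
  set N := peirceU K e ⊔ peirceV K e
  have hN : subMul N N ≤ N := Submodule.map₂_le.2 fun x hx y hy ↦ h.mul_mem_sup hx hy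
  have h1 : ∀ k, ∃ n, 1 ≤ n ∧ ∀ m, n ≤ m → algPow N m ≤ J k := by
    intro k
    induction k with
    | zero => exact ⟨1, le_rfl, fun m _ ↦ (algPow_le hN m).trans hJ0⟩
    | succ k ih =>
      obtain ⟨n, hn, h⟩ := exists_algPow_le_subMul hN ih
      exact ⟨n, hn, fun m hm ↦ (h m hm).trans (hJ k)⟩
  have h2 : ∀ k, ∃ n, 1 ≤ n ∧ ∀ m, n ≤ m →
      algPow N m ≤ (subMul (peirceV K e))^[k] (annU K e) := by
    intro k
    induction k with
    | zero =>
      obtain ⟨n, hn, h⟩ := h1 n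
      exact ⟨n, hn, fun m hm ↦ (h m hm).trans hJn⟩
    | succ k ih =>
      obtain ⟨n, hn, h'⟩ := exists_algPow_le_subMul hN ih
      refine ⟨n, hn, fun m hm ↦ (h' m hm).trans ?_⟩
      rw [Function.iterate_succ_apply']
      exact subMul_annU_le (h.iterate_annU k).1
  obtain ⟨n, hn, h3⟩ := h2 j
  exact ⟨n, hn, le_bot_iff.1 (hj ▸ h3 n le_rfl)⟩

theorem adjoin_pow_eq_bot (h : IsBernstein ω e) {n : ℕ} (hn : 1 ≤ n)
    (hbot : algPow (peirceU K e ⊔ peirceV K e) n = ⊥) :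
    (NonUnitalAlgebra.adjoin K
      {L : Module.End K ↥(peirceU K e ⊔ peirceV K e) |
        ∃ v ∈ peirceV K e, ∀ x : ↥(peirceU K e ⊔ peirceV K e),
          (L x : A) = v * (x : A)}).toSubmodule ^ n = ⊥ := by
  set N := peirceU K e ⊔ peirceV K e with hN
  set F : ℕ → Submodule K A := fun k ↦ (subMul N)^[k] N with hF
  have hanti : ∀ k, F (k + 1) ≤ F k := by
    intro k
    induction k with
    | zero => exact Submodule.map₂_le.2 fun x hx y hy ↦ h.mul_mem_sup hx hy
    | succ k ih =>
      simp only [hF, Function.iterate_succ_apply'] at ih ⊢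
      exact Submodule.map₂_le_map₂_right ih
  have hF_mul : ∀ k, ∀ v ∈ N, ∀ x ∈ F k, v * x ∈ F (k + 1) := by
    intro k v hv x hx
    simp only [hF, Function.iterate_succ_apply']
    exact Submodule.apply_mem_map₂ (LinearMap.mul K A) hv hx
  have hadj : ∀ L ∈ NonUnitalAlgebra.adjoin K
      {L : Module.End K N | ∃ v ∈ peirceV K e, ∀ x : N, (L x : A) = v * (x : A)},
      ∀ k, ∀ x : N, (x : A) ∈ F k → (L x : A) ∈ F (k + 1) := by
    intro L hL
    induction hL using NonUnitalAlgebra.adjoin_induction with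
    | mem L hL =>
      obtain ⟨v, hv, hL⟩ := hL
      intro k x hx
      rw [hL]
      exact hF_mul k v (Submodule.mem_sup_right hv) x hx
    | add L L' _ _ ih ih' => exact fun k x hx ↦ add_mem (ih k x hx) (ih' k x hx)
    | zero => exact fun k x _ ↦ zero_mem _
    | mul L L' _ _ ih ih' => exact fun k x hx ↦ hanti _ (ih _ _ (ih' k x hx))
    | smul c L _ ih => exact fun k x hx ↦ Submodule.smul_mem _ c (ih k x hx)
  set B := (NonUnitalAlgebra.adjoin K
      {L : Module.End K N | ∃ v ∈ peirceV K e, ∀ x : N, (L x : A) = v * (x : A)}).toSubmodule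
  have hpow : ∀ j, ∀ L ∈ B ^ j, ∀ k, ∀ x : N, (x : A) ∈ F k → (L x : A) ∈ F (k + j) := by
    intro j
    induction j with
    | zero =>
      intro L hL k x hx
      rw [pow_zero] at hL
      obtain ⟨c, rfl⟩ := Submodule.mem_one.1 hL
      exact Submodule.smul_mem _ c hx
    | succ j ih =>
      intro L hL k x hx
      rw [pow_succ'] at hL
      exact Submodule.mul_induction_on (C := fun L ↦ (L x : A) ∈ F (k + (j + 1))) hL
        (fun L hL L' hL' ↦ hadj L hL _ _ (ih L' hL' k x hx)) fun L L' hL hL' ↦ add_mem hL hL'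
  obtain ⟨n, rfl⟩ : ∃ k, n = k + 1 := ⟨n - 1, by omega⟩
  have hFn : F (n + 1) = ⊥ :=
    le_bot_iff.1 ((hanti n).trans (hbot ▸ iterate_subMul_le_algPow N n))
  refine (Submodule.eq_bot_iff _).2 fun L hL ↦ LinearMap.ext fun x ↦ Subtype.ext ?_
  have := hpow _ L hL 0 x x.2
  rwa [zero_add, hFn, Submodule.mem_bot] at this

theorem eq_bot_of_adjoin_pow_eq_bot (h : IsBernstein ω e) {n : ℕ}
    (hn : (NonUnitalAlgebra.adjoin K
      {L : Module.End K ↥(peirceU K e ⊔ peirceV K e) |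
        ∃ v ∈ peirceV K e, ∀ x : ↥(peirceU K e ⊔ peirceV K e),
          (L x : A) = v * (x : A)}).toSubmodule ^ n = ⊥)
    {I : Submodule K A} (hI : subMul (peirceV K e) I = I) : I = ⊥ := by
  set N := peirceU K e ⊔ peirceV K e with hN
  set B := (NonUnitalAlgebra.adjoin K
      {L : Module.End K N | ∃ v ∈ peirceV K e, ∀ x : N, (L x : A) = v * (x : A)}).toSubmodule
  have hIN : I ≤ N := by
    rw [← hI]
    refine Submodule.map₂_le.2 fun v hv a _ ↦ ?_
    obtain ⟨c, u, hu, w, hw, rfl⟩ := h.exists_decomp a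
    rw [LinearMap.mul_apply', add_assoc, mul_add, mul_smul_comm, mul_comm v e,
      show e * v = 0 from hv, smul_zero, zero_add]
    exact h.mul_mem_sup (Submodule.mem_sup_right hv) (Submodule.add_mem_sup hu hw)
  set ev : Module.End K N →ₗ[K] N →ₗ[K] A :=
    (LinearMap.id : Module.End K N →ₗ[K] N →ₗ[K] N).compr₂ N.subtype
  have key : ∀ j, I ≤ Submodule.map₂ ev (B ^ j) ⊤ := by
    intro j
    induction j with
    | zero =>
      intro x hx
      exact Submodule.apply_mem_map₂ ev (m := (1 : Module.End K N)) (n := ⟨x, hIN hx⟩)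
        (by rw [pow_zero]; exact Submodule.one_le.1 le_rfl) trivial
    | succ j ih =>
      rw [← hI]
      refine Submodule.map₂_le.2 fun v hv x hx ↦ ?_
      have hvN : ∀ y ∈ N, LinearMap.mulLeft K v y ∈ N := fun y hy ↦
        h.mul_mem_sup (Submodule.mem_sup_right hv) hy
      set L : Module.End K N := (LinearMap.mulLeft K v).restrict hvN
      have hL : L ∈ B := NonUnitalAlgebra.subset_adjoin K ⟨v, hv, fun _ ↦ rfl⟩
      have hle : Submodule.map₂ ev (B ^ j) ⊤ ≤
          (Submodule.map₂ ev (B ^ (j + 1)) ⊤).comap (LinearMap.mulLeft K v) := by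
        refine Submodule.map₂_le.2 fun L' hL' y _ ↦ ?_
        refine Submodule.apply_mem_map₂ ev (m := L * L') (n := y) ?_ trivial
        rw [pow_succ']
        exact Submodule.mul_mem_mul hL hL'
      exact hle (ih hx)
  have := key n
  rwa [hn, Submodule.map₂_bot_left, le_bot_iff] at this

end IsBernstein

end Bernstein

/-- Let `A` be an Artinian Bernstein algebra over a field `K` of
characteristic `≠ 2, 3`, with Peirce decomposition `A = Ke ⊕ U ⊕ V` relative to an idempotent
`e` of weight `1` and barideal `N = U ⊕ V`.  The following are equivalent:
(i) the ideal `N` is nilpotent;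
(ii) the associative subalgebra of `End_K(N)` generated by the multiplication operators
`L_v : N → N`, `x ↦ v x` (`v ∈ V`), is nilpotent;
(iii) the only subspace `I` of `A` with `VI = I` is `I = 0`. -/
theorem artinian_bernstein_barideal_nilpotent_tfae {K A : Type*} [Field K]
    [NonUnitalNonAssocCommRing A] [Module K A] [SMulCommClass K A A] [IsScalarTower K A A]
    (h2 : (2 : K) ≠ 0) (h3 : (3 : K) ≠ 0)
    (ω : A →ₗ[K] K) (hωmul : ∀ x y : A, ω (x * y) = ω x * ω y) (hω0 : ω ≠ 0)
    (hbern : ∀ x : A, (x * x) * (x * x) = ω x ^ 2 • (x * x))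
    (e : A) (he : e * e = e) (hωe : ω e = 1)
    -- `A` is Artinian : d.c.c. on ideals of `A`
    (hart : ∀ f : ℕ → Submodule K A, (∀ k, ∀ a : A, ∀ x ∈ f k, a * x ∈ f k) → Antitone f →
      ∃ n, ∀ m, n ≤ m → f m = f n) :
    List.TFAE
      [ -- (i) the barideal `N = U ⊕ V` is nilpotent
        ∃ n, 1 ≤ n ∧ algPow (peirceU K e ⊔ peirceV K e) n = ⊥,
        -- (ii) the associative algebra generated by the operators `L_v (v ∈ V)` is nilpotent
        ∃ n, 1 ≤ n ∧
          (NonUnitalAlgebra.adjoin K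
            {L : Module.End K ↥(peirceU K e ⊔ peirceV K e) |
              ∃ v ∈ peirceV K e, ∀ x : ↥(peirceU K e ⊔ peirceV K e),
                (L x : A) = v * (x : A)}).toSubmodule ^ n = ⊥,
        -- (iii) the only subspace `I` with `VI = I` is `I = 0`
        ∀ I : Submodule K A, subMul (peirceV K e) I = I → I = ⊥ ] := by
  have h : IsBernstein ω e := ⟨h2, h3, hωmul, hbern, he, hωe⟩
  tfae_have 1 → 2 := fun ⟨n, hn, hbot⟩ ↦ ⟨n, hn, h.adjoin_pow_eq_bot hn hbot⟩
  tfae_have 2 → 3 := fun ⟨_, _, hn⟩ _ hI ↦ h.eq_bot_of_adjoin_pow_eq_bot hn hI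
  tfae_have 3 → 1 := h.algPow_eq_bot hart
  tfae_finish
end

section
/- Let A be any Bernstein algebra over a field K of characteristic ≠ 2, 3 (not assumed Artinian), with Peirce decomposition A = Ke ⊕ U ⊕ V relative to an idempotent e of weight 1, and barideal N = U ⊕ V. If the barideal N is nilpotent, then the associative subalgebra of End_K(N) generated by the left-multiplication operators L_v : N → N (x ↦ vx), v ∈ V, is nilpotent; and if this associative algebra is nilpotent, then the only K-subspace I of A satisfying VI = I is I = 0. -/
section Powers

variable {K A : Type*} [Field K] [NonUnitalNonAssocRing A] [Module K A]
  [SMulCommClass K A A] [IsScalarTower K A A]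

theorem subMul_mono {M M' N N' : Submodule K A} (hM : M ≤ M') (hN : N ≤ N') :
    subMul M N ≤ subMul M' N' :=
  Submodule.map₂_le_map₂ hM hN

theorem mul_mem_subMul {M N : Submodule K A} {x y : A} (hx : x ∈ M) (hy : y ∈ N) :
    x * y ∈ subMul M N :=
  Submodule.apply_mem_map₂ (LinearMap.mul K A) hx hy

theorem algPow_one (S : Submodule K A) : algPow S 1 = S := by
  rw [algPow]

theorem algPow_add_two (S : Submodule K A) (n : ℕ) :
    algPow S (n + 2) =
      ⨆ r : Fin (n + 1), subMul (algPow S (r + 1)) (algPow S (n + 1 - r)) := by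
  rw [algPow]

theorem subMul_algPow_le (S : Submodule K A) (a b : ℕ) :
    subMul (algPow S (a + 1)) (algPow S (b + 1)) ≤ algPow S (a + b + 2) := by
  rw [algPow_add_two]
  have h : a + b + 1 - a = b + 1 := by omega
  exact le_iSup_of_le (⟨a, by omega⟩ : Fin (a + b + 1)) (by simp only [h, le_refl])

/-- The powers of a subalgebra form a decreasing sequence. -/
theorem algPow_succ_le {S : Submodule K A} (hS : subMul S S ≤ S) (n : ℕ) :
    algPow S (n + 2) ≤ algPow S (n + 1) := by
  induction n using Nat.strong_induction_on with
  | _ n ih =>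
    rw [algPow_add_two]
    refine iSup_le fun ⟨r, hr⟩ => ?_
    rcases r with _ | r
    · rcases n with _ | n
      · simpa [algPow_one] using hS
      · have h := subMul_algPow_le S 0 n
        simp only [zero_add] at h
        exact (subMul_mono le_rfl (ih n (by omega))).trans h
    · obtain ⟨m, rfl⟩ : ∃ m, n = r + m + 1 := ⟨n - r - 1, by omega⟩
      have h : r + m + 1 + 1 - (r + 1) = m + 1 := by omega
      simp only [h]
      exact (subMul_mono (ih r (by omega)) le_rfl).trans (subMul_algPow_le S r m)

end Powers

section Peirce

variable {K A : Type*} [Field K] [NonUnitalNonAssocCommRing A] [Module K A]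
  [SMulCommClass K A A] [IsScalarTower K A A]

/-- On the barideal, left multiplication by `e` satisfies `2 L_e² = L_e`. -/
theorem two_smul_idempotent_mul_mul (h2 : (2 : K) ≠ 0) (h3 : (3 : K) ≠ 0) {ω : A →ₗ[K] K}
    (hbern : ∀ x : A, (x * x) * (x * x) = ω x ^ 2 • (x * x))
    {e : A} (he : e * e = e) (hωe : ω e = 1) {x : A} (hx : ω x = 0) :
    (2 : K) • (e * (e * x)) = e * x := by
  have key (t : K) : (4 * t) • (e * (e * x)) + (4 * t ^ 2) • ((e * x) * (e * x))
      + (2 * t ^ 2) • (e * (x * x)) + (4 * t ^ 3) • ((e * x) * (x * x))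
      + t ^ 4 • ((x * x) * (x * x)) = (2 * t) • (e * x) + t ^ 2 • (x * x) := by
    have hsq : (e + t • x) * (e + t • x) = e + (2 * t) • (e * x) + t ^ 2 • (x * x) := by
      simp only [mul_add, add_mul, smul_mul_assoc, mul_smul_comm, he, mul_comm x e]
      module
    have hb := hbern (e + t • x)
    rw [hsq] at hb
    simp only [map_add, map_smul, hωe, hx, smul_zero, add_zero, one_pow, one_smul, mul_add,
      add_mul, smul_mul_assoc, mul_smul_comm, he, mul_comm (e * x) e, mul_comm (x * x) e,
      mul_comm (x * x) (e * x)] at hb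
    rw [← sub_eq_zero] at hb ⊢
    rw [← hb]
    module
  have h : (24 : K) • ((2 : K) • (e * (e * x)) - e * x) = 0 := by
    linear_combination (norm := module) (8 : K) • key 1 - (8 : K) • key (-1) - key 2 + key (-2)
  have h24 : (24 : K) ≠ 0 := by
    rw [show (24 : K) = 2 ^ 3 * 3 by norm_num]
    exact mul_ne_zero (pow_ne_zero 3 h2) h3
  exact sub_eq_zero.mp ((smul_eq_zero.mp h).resolve_left h24)

theorem peirceV_le_ker {ω : A →ₗ[K] K} (hωmul : ∀ x y : A, ω (x * y) = ω x * ω y)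
    {e : A} (hωe : ω e = 1) : peirceV K e ≤ LinearMap.ker ω := by
  intro v hv
  have h : e * v = 0 := hv
  simpa [hωmul, hωe] using congrArg ω h

theorem peirceU_le_ker (h2 : (2 : K) ≠ 0) {ω : A →ₗ[K] K}
    (hωmul : ∀ x y : A, ω (x * y) = ω x * ω y)
    {e : A} (hωe : ω e = 1) : peirceU K e ≤ LinearMap.ker ω := by
  intro u hu
  have h : e * u = (2 : K)⁻¹ • u := hu
  have hu2 : ω u = (2 : K)⁻¹ * ω u := by simpa [hωmul, hωe] using congrArg ω h
  rw [LinearMap.mem_ker]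
  field_simp at hu2
  linear_combination hu2

/-- The barideal is the sum of the Peirce components `U` and `V`. -/
theorem peirceU_sup_peirceV_eq_ker (h2 : (2 : K) ≠ 0) (h3 : (3 : K) ≠ 0) {ω : A →ₗ[K] K}
    (hωmul : ∀ x y : A, ω (x * y) = ω x * ω y)
    (hbern : ∀ x : A, (x * x) * (x * x) = ω x ^ 2 • (x * x))
    {e : A} (he : e * e = e) (hωe : ω e = 1) :
    peirceU K e ⊔ peirceV K e = LinearMap.ker ω := by
  refine le_antisymm (sup_le (peirceU_le_ker h2 hωmul hωe) (peirceV_le_ker hωmul hωe)) ?_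
  intro x hx
  have hL := two_smul_idempotent_mul_mul h2 h3 hbern he hωe (LinearMap.mem_ker.mp hx)
  refine Submodule.mem_sup.mpr ⟨(2 : K) • (e * x), ?_, x - (2 : K) • (e * x), ?_, by abel⟩
  · change e * ((2 : K) • (e * x)) = (2 : K)⁻¹ • (2 : K) • (e * x)
    rw [mul_smul_comm, hL, inv_smul_smul₀ h2]
  · change e * (x - (2 : K) • (e * x)) = 0
    rw [mul_sub, mul_smul_comm, hL, sub_self]

end Peirce

section LeftMultiplications

variable {K A : Type*} [Field K] [NonUnitalNonAssocCommRing A] [Module K A]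
  [SMulCommClass K A A] [IsScalarTower K A A]

/-- If a subalgebra `N` is nilpotent, then so is the associative algebra generated by the
operators of multiplication on `N` by the elements of a subspace `V` of `N`. -/
theorem adjoin_leftMul_pow_eq_bot {N V : Submodule K A} (hVN : V ≤ N) (hN : subMul N N ≤ N)
    {n : ℕ} (hn : algPow N (n + 1) = ⊥) :
    (NonUnitalAlgebra.adjoin K {L : Module.End K N |
      ∃ v ∈ V, ∀ x : N, (L x : A) = v * (x : A)}).toSubmodule ^ (n + 1) = ⊥ := by
  set B := NonUnitalAlgebra.adjoin K {L : Module.End K N |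
    ∃ v ∈ V, ∀ x : N, (L x : A) = v * (x : A)}
  have hstep : ∀ T ∈ B, ∀ i, ∀ x : N,
      (x : A) ∈ algPow N (i + 1) → (T x : A) ∈ algPow N (i + 2) := by
    intro T hT
    induction hT using NonUnitalAlgebra.adjoin_induction with
    | mem L hL =>
      obtain ⟨v, hv, hL⟩ := hL
      intro i x hx
      rw [hL]
      have h := subMul_algPow_le N 0 i
      simp only [zero_add, algPow_one] at h
      exact h (mul_mem_subMul (hVN hv) hx)
    | add S T _ _ hS hT => exact fun i x hx => add_mem (hS i x hx) (hT i x hx)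
    | zero => exact fun i x hx => zero_mem _
    | mul S T _ _ hS hT =>
      exact fun i x hx => algPow_succ_le hN (i + 1) (hS (i + 1) (T x) (hT i x hx))
    | smul c T _ hT => exact fun i x hx => Submodule.smul_mem _ c (hT i x hx)
  have hpow : ∀ m, ∀ T ∈ B.toSubmodule ^ m, ∀ i, ∀ x : N,
      (x : A) ∈ algPow N (i + 1) → (T x : A) ∈ algPow N (i + m + 1) := by
    intro m
    induction m with
    | zero =>
      intro T hT i x hx
      rw [pow_zero, Submodule.mem_one] at hT
      obtain ⟨c, rfl⟩ := hT
      exact Submodule.smul_mem _ c hx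
    | succ m ih =>
      intro T hT
      rw [pow_succ'] at hT
      induction hT using Submodule.mul_induction_on' with
      | mem_mul_mem S hS T hT => exact fun i x hx => hstep S hS (i + m) (T x) (ih T hT i x hx)
      | add S _ T _ hS hT => exact fun i x hx => add_mem (hS i x hx) (hT i x hx)
  rw [eq_bot_iff]
  intro T hT
  rw [Submodule.mem_bot]
  ext x
  have h := algPow_succ_le hN n
    (by simpa [add_assoc] using hpow (n + 1) T hT 0 x (by simp [algPow_one]))
  rw [hn] at h
  simpa using h

/-- If the associative algebra generated by the multiplications on `N` by elements of `V` is
nilpotent, then no nonzero subspace `I` of `N` satisfies `I ≤ V I`. -/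
theorem eq_bot_of_le_subMul_of_adjoin_leftMul_pow_eq_bot {N V : Submodule K A}
    (hVN : V ≤ N) (hN : subMul N N ≤ N) {n : ℕ}
    (hn : (NonUnitalAlgebra.adjoin K {L : Module.End K N |
      ∃ v ∈ V, ∀ x : N, (L x : A) = v * (x : A)}).toSubmodule ^ n = ⊥)
    {I : Submodule K A} (hIN : I ≤ N) (hI : I ≤ subMul V I) : I = ⊥ := by
  set B := NonUnitalAlgebra.adjoin K {L : Module.End K N |
    ∃ v ∈ V, ∀ x : N, (L x : A) = v * (x : A)}
  have hleft : ∀ v ∈ V, ∃ L ∈ B, ∀ x : N, (L x : A) = v * (x : A) := by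
    intro v hv
    let L : Module.End K N := (LinearMap.mulLeft K v).restrict
      fun x hx => hN (mul_mem_subMul (hVN hv) hx)
    have hL : ∀ x : N, (L x : A) = v * (x : A) := fun _ => rfl
    exact ⟨L, NonUnitalAlgebra.subset_adjoin K ⟨v, hv, hL⟩, hL⟩
  have hpow : ∀ m, ∀ W : Submodule K N,
      (∀ T ∈ B.toSubmodule ^ m, ∀ x : N, (x : A) ∈ I → T x ∈ W) →
        ∀ x : N, (x : A) ∈ I → x ∈ W := by
    intro m
    induction m with
    | zero => exact fun W h x hx => h 1 (by rw [pow_zero]; exact Submodule.one_le.mp le_rfl) x hx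
    | succ m ih =>
      intro W h
      refine ih W fun T hT x hx => ?_
      have hle : subMul V I ≤ (W.comap T).map N.subtype := by
        refine Submodule.map₂_le.mpr fun v hv y hy => ?_
        obtain ⟨L, hLB, hL⟩ := hleft v hv
        refine ⟨L ⟨y, hIN hy⟩, ?_, hL _⟩
        exact h (T * L) (by rw [pow_succ]; exact Submodule.mul_mem_mul hT hLB) ⟨y, hIN hy⟩ hy
      obtain ⟨y, hy, hyx⟩ := hle (hI hx)
      rwa [← Subtype.ext hyx]
  rw [eq_bot_iff]
  intro x hx
  have h : (⟨x, hIN hx⟩ : N) ∈ (⊥ : Submodule K N) := by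
    refine hpow n ⊥ (fun T hT y _ => ?_) _ hx
    rw [hn, Submodule.mem_bot] at hT
    simp [hT]
  simpa using h

end LeftMultiplications

/-- Let `A` be any Bernstein algebra over a field `K` of characteristic
`≠ 2, 3` (not assumed Artinian), with Peirce decomposition `A = Ke ⊕ U ⊕ V` relative to an
idempotent `e` of weight `1` and barideal `N = U ⊕ V`.  If `N` is nilpotent then the associative
subalgebra of `End_K(N)` generated by the operators `L_v : N → N`, `x ↦ v x` (`v ∈ V`), is
nilpotent; and if this associative algebra is nilpotent then the only subspace `I` of `A` with
`VI = I` is `I = 0`. -/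
theorem bernstein_barideal_nilpotent_implications {K A : Type*} [Field K]
    [NonUnitalNonAssocCommRing A] [Module K A] [SMulCommClass K A A] [IsScalarTower K A A]
    (h2 : (2 : K) ≠ 0) (h3 : (3 : K) ≠ 0)
    (ω : A →ₗ[K] K) (hωmul : ∀ x y : A, ω (x * y) = ω x * ω y) (hω0 : ω ≠ 0)
    (hbern : ∀ x : A, (x * x) * (x * x) = ω x ^ 2 • (x * x))
    (e : A) (he : e * e = e) (hωe : ω e = 1) :
    -- if the barideal `N = U ⊕ V` is nilpotent, then the associative algebra generated by
    -- the operators `L_v (v ∈ V)` is nilpotent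
    ((∃ n, 1 ≤ n ∧ algPow (peirceU K e ⊔ peirceV K e) n = ⊥) →
      ∃ n, 1 ≤ n ∧
        (NonUnitalAlgebra.adjoin K
          {L : Module.End K ↥(peirceU K e ⊔ peirceV K e) |
            ∃ v ∈ peirceV K e, ∀ x : ↥(peirceU K e ⊔ peirceV K e),
              (L x : A) = v * (x : A)}).toSubmodule ^ n = ⊥) ∧
    -- if that associative algebra is nilpotent, then the only subspace `I` with `VI = I`
    -- is `I = 0`
    ((∃ n, 1 ≤ n ∧
        (NonUnitalAlgebra.adjoin K
          {L : Module.End K ↥(peirceU K e ⊔ peirceV K e) |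
            ∃ v ∈ peirceV K e, ∀ x : ↥(peirceU K e ⊔ peirceV K e),
              (L x : A) = v * (x : A)}).toSubmodule ^ n = ⊥) →
      ∀ I : Submodule K A, subMul (peirceV K e) I = I → I = ⊥) := by
  have hker := peirceU_sup_peirceV_eq_ker h2 h3 hωmul hbern he hωe
  have hVN : peirceV K e ≤ peirceU K e ⊔ peirceV K e := le_sup_right
  have hV := peirceV_le_ker hωmul hωe
  have hideal : ∀ M : Submodule K A, subMul (LinearMap.ker ω) M ≤ LinearMap.ker ω :=
    fun M => Submodule.map₂_le.mpr fun x hx y _ => by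
      rw [LinearMap.mem_ker] at hx ⊢
      simp [hωmul, hx]
  have hN : subMul (peirceU K e ⊔ peirceV K e) (peirceU K e ⊔ peirceV K e) ≤
      peirceU K e ⊔ peirceV K e := by
    rw [hker]
    exact hideal _
  refine ⟨?_, ?_⟩
  · rintro ⟨n, hn1, hn⟩
    obtain ⟨m, rfl⟩ := Nat.exists_eq_add_of_le' hn1
    exact ⟨m + 1, hn1, adjoin_leftMul_pow_eq_bot hVN hN hn⟩
  · rintro ⟨n, -, hn⟩ I hI
    refine eq_bot_of_le_subMul_of_adjoin_leftMul_pow_eq_bot hVN hN hn ?_ hI.ge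
    rw [hker]
    exact hI.ge.trans ((subMul_mono hV le_rfl).trans (hideal I))
end

section
/- Let K be a field of characteristic ≠ 2, 3 and let N be a commutative (not necessarily associative) K-algebra satisfying the identity x³ = 0 (where x³ = x²·x) and such that the quotient N/N² is finite-dimensional over K, where N² is the linear span of all products of two elements of N. Then N is finite-dimensional over K. -/
namespace CubeZero

section Words

/-- The assignment of `a, b, c, d` to the letters `0, 1, 2, 3`. -/
def letters {α : Type*} (a b c d : α) : ℕ → α
  | 0 => a
  | 1 => b
  | 2 => c
  | _ => d

/-- The letter permutation exchanging `0` and `1`. -/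
def swapLeft : ℕ → ℕ
  | 0 => 1
  | 1 => 0
  | n => n

/-- The letter permutation exchanging `2` and `3`. -/
def swapRight : ℕ → ℕ
  | 0 => 0
  | 1 => 1
  | 2 => 3
  | _ => 2

/-- The letter permutation exchanging `0` with `2` and `1` with `3`. -/
def swapPairs : ℕ → ℕ
  | 0 => 2
  | 1 => 3
  | 2 => 0
  | _ => 1

lemma letters_comp_swapLeft {α : Type*} (a b c d : α) :
    letters a b c d ∘ swapLeft = letters b a c d := by
  funext n
  match n with
  | 0 | 1 | 2 | _ + 3 => rfl

lemma letters_comp_swapRight {α : Type*} (a b c d : α) :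
    letters a b c d ∘ swapRight = letters a b d c := by
  funext n
  match n with
  | 0 | 1 | 2 | _ + 3 => rfl

lemma letters_comp_swapPairs {α : Type*} (a b c d : α) :
    letters a b c d ∘ swapPairs = letters c d a b := by
  funext n
  match n with
  | 0 | 1 | 2 | _ + 3 => rfl

variable {R : Type*} [Ring R]

/-- The value of a word in the letters `0, 1, 2, …` at the assignment `f`. -/
def evalWord (f : ℕ → R) (w : List ℕ) : R := (w.map f).prod

/-- All concatenations of a word of `A` with a word of `B`. -/
def mulWords (A B : List (List ℕ)) : List (List ℕ) := A.flatMap fun u => B.map fun v => u ++ v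

/-- The words occurring in the iterated anticommutator `i₁ ∘ (i₂ ∘ (⋯ ∘ iₖ))`, where
`u ∘ v = u * v + v * u`. -/
def jordanWords : List ℕ → List (List ℕ)
  | [] => []
  | [i] => [[i]]
  | i :: l => mulWords [[i]] (jordanWords l) ++ mulWords (jordanWords l) [[i]]

/-- The words of the full symmetrization of a product of three iterated anticommutators,
multiplied by a word on either side. -/
def symmWords (pre x y z post : List ℕ) : List (List ℕ) :=
  let X := jordanWords x
  let Y := jordanWords y
  let Z := jordanWords z
  mulWords (mulWords [pre]
    (mulWords (mulWords X Y) Z ++ mulWords (mulWords X Z) Y ++ mulWords (mulWords Y X) Z ++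
      mulWords (mulWords Y Z) X ++ mulWords (mulWords Z X) Y ++ mulWords (mulWords Z Y) X)) [post]

lemma sum_evalWord_mulWords (f : ℕ → R) (A B : List (List ℕ)) :
    ((mulWords A B).map (evalWord f)).sum =
      (A.map (evalWord f)).sum * (B.map (evalWord f)).sum := by
  induction A with
  | nil => simp [mulWords]
  | cons u A ih =>
    have h : ((B.map fun v => u ++ v).map (evalWord f)).sum =
        evalWord f u * (B.map (evalWord f)).sum := by
      rw [List.map_map, ← List.sum_map_mul_left]
      simp [evalWord, Function.comp_def]
    simp only [mulWords] at ih
    simp only [mulWords, List.flatMap_cons, List.map_append, List.sum_append, h, ih, List.map_cons,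
      List.sum_cons, add_mul]

/-- A set of ring elements closed under the anticommutator whose fully symmetrized
triple products vanish. -/
structure IsCubeZeroJordan (J : Set R) : Prop where
  zero_mem : 0 ∈ J
  anticomm_mem : ∀ u ∈ J, ∀ v ∈ J, u * v + v * u ∈ J
  symm_eq_zero : ∀ u ∈ J, ∀ v ∈ J, ∀ w ∈ J,
    u * v * w + u * w * v + v * u * w + v * w * u + w * u * v + w * v * u = 0

lemma IsCubeZeroJordan.sum_jordanWords_mem {J : Set R} (hJ : IsCubeZeroJordan J) {f : ℕ → R}
    (hf : ∀ i, f i ∈ J) (l : List ℕ) : ((jordanWords l).map (evalWord f)).sum ∈ J := by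
  induction l using jordanWords.induct with
  | case1 => simpa [jordanWords] using hJ.zero_mem
  | case2 i => simpa [jordanWords, evalWord] using hf i
  | case3 i l hl ih =>
    rw [jordanWords.eq_3 _ _ hl, List.map_append, List.sum_append, sum_evalWord_mulWords,
      sum_evalWord_mulWords]
    simpa [evalWord] using hJ.anticomm_mem _ (hf i) _ ih

lemma IsCubeZeroJordan.sum_symmWords {J : Set R} (hJ : IsCubeZeroJordan J) {f : ℕ → R}
    (hf : ∀ i, f i ∈ J) (pre x y z post : List ℕ) :
    ((symmWords pre x y z post).map (evalWord f)).sum = 0 := by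
  simp only [symmWords, sum_evalWord_mulWords, List.map_append, List.sum_append]
  rw [hJ.symm_eq_zero _ (hJ.sum_jordanWords_mem hf x) _ (hJ.sum_jordanWords_mem hf y) _
    (hJ.sum_jordanWords_mem hf z)]
  simp

lemma IsCubeZeroJordan.op {J : Set R} (hJ : IsCubeZeroJordan J) :
    IsCubeZeroJordan (MulOpposite.unop ⁻¹' J) where
  zero_mem := hJ.zero_mem
  anticomm_mem u hu v hv := by
    simpa [add_comm] using hJ.anticomm_mem _ hu _ hv
  symm_eq_zero u hu v hv w hw := by
    apply MulOpposite.unop_injective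
    rw [MulOpposite.unop_zero, ← hJ.symm_eq_zero _ hu _ hv _ hw]
    simp only [MulOpposite.unop_add, MulOpposite.unop_mul, mul_assoc]
    abel

lemma evalWord_reverse (f : ℕ → R) (w : List ℕ) :
    evalWord f w.reverse = (evalWord (MulOpposite.op ∘ f) w).unop := by
  simp [evalWord, MulOpposite.unop_list_prod, Function.comp_def]

lemma IsCubeZeroJordan.sum_symmWords_reverse {J : Set R} (hJ : IsCubeZeroJordan J) {f : ℕ → R}
    (hf : ∀ i, f i ∈ J) (pre x y z post : List ℕ) :
    ((symmWords pre x y z post).map fun w => evalWord f w.reverse).sum = 0 := by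
  have h := hJ.op.sum_symmWords (f := MulOpposite.op ∘ f) hf pre x y z post
  have h' := congrArg (MulOpposite.opAddEquiv (α := R)).symm h
  rw [map_list_sum, List.map_map, map_zero] at h'
  simpa [evalWord_reverse, Function.comp_def] using h'

/-- The sum of the values of a word and of its reverse. -/
def evalWordRev (a b c d : R) (w : List ℕ) : R :=
  evalWord (letters a b c d) w + evalWord (letters a b c d) w.reverse

/-- The value of a word, symmetrized under reversal and under the permutations of the letters
preserving the partition `{{0, 1}, {2, 3}}`. -/
def symmEval (a b c d : R) (w : List ℕ) : R :=
  evalWordRev a b c d w + evalWordRev b a c d w + evalWordRev a b d c w + evalWordRev b a d c w +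
    evalWordRev c d a b w + evalWordRev d c a b w + evalWordRev c d b a w + evalWordRev d c b a w

lemma sum_evalWordRev_symmWords {J : Set R} (hJ : IsCubeZeroJordan J) {a b c d : R} (ha : a ∈ J)
    (hb : b ∈ J) (hc : c ∈ J) (hd : d ∈ J) (pre x y z post : List ℕ) :
    ((symmWords pre x y z post).map (evalWordRev a b c d)).sum = 0 := by
  have hf : ∀ i, letters a b c d i ∈ J := by
    intro i
    match i with
    | 0 => exact ha
    | 1 => exact hb
    | 2 => exact hc
    | _ + 3 => exact hd
  unfold evalWordRev
  rw [List.sum_map_add, hJ.sum_symmWords hf, hJ.sum_symmWords_reverse hf, add_zero]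

lemma sum_symmEval_symmWords {J : Set R} (hJ : IsCubeZeroJordan J) {a b c d : R} (ha : a ∈ J)
    (hb : b ∈ J) (hc : c ∈ J) (hd : d ∈ J) (pre x y z post : List ℕ) :
    ((symmWords pre x y z post).map (symmEval a b c d)).sum = 0 := by
  unfold symmEval
  simp only [List.sum_map_add]
  simp only [sum_evalWordRev_symmWords hJ, ha, hb, hc, hd, add_zero]

lemma evalWordRev_map {g : ℕ → ℕ} {a b c d a' b' c' d' : R}
    (h : letters a b c d ∘ g = letters a' b' c' d') (w : List ℕ) :
    evalWordRev a b c d (w.map g) = evalWordRev a' b' c' d' w := by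
  simp [evalWordRev, evalWord, ← h, ← List.map_reverse]

lemma symmEval_map_swapLeft (a b c d : R) (w : List ℕ) :
    symmEval a b c d (w.map swapLeft) = symmEval a b c d w := by
  simp only [symmEval, evalWordRev_map (letters_comp_swapLeft _ _ _ _)]
  abel

lemma symmEval_map_swapRight (a b c d : R) (w : List ℕ) :
    symmEval a b c d (w.map swapRight) = symmEval a b c d w := by
  simp only [symmEval, evalWordRev_map (letters_comp_swapRight _ _ _ _)]
  abel

lemma symmEval_map_swapPairs (a b c d : R) (w : List ℕ) :
    symmEval a b c d (w.map swapPairs) = symmEval a b c d w := by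
  simp only [symmEval, evalWordRev_map (letters_comp_swapPairs _ _ _ _)]
  abel

lemma symmEval_reverse (a b c d : R) (w : List ℕ) :
    symmEval a b c d w.reverse = symmEval a b c d w := by
  simp only [symmEval, evalWordRev, List.reverse_reverse]
  abel

/-- Rename the letters, preserving the partition `{{0, 1}, {2, 3}}`, so that `0` comes before
the other letters and `2` comes before `3`. -/
def renameLetters (w : List ℕ) : List ℕ :=
  let w₁ := bif w.headD 0 < 2 then w else w.map swapPairs
  let w₂ := bif w₁.headD 0 == 0 then w₁ else w₁.map swapLeft
  bif w₂.find? (1 < ·) == some 3 then w₂.map swapRight else w₂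

lemma symmEval_renameLetters (a b c d : R) (w : List ℕ) :
    symmEval a b c d (renameLetters w) = symmEval a b c d w := by
  simp only [renameLetters, Bool.cond_eq_ite, apply_ite (symmEval a b c d), symmEval_map_swapLeft,
    symmEval_map_swapRight, symmEval_map_swapPairs, ite_self]

/-- The word read as a number in base four. -/
def code (w : List ℕ) : ℕ := w.foldl (fun n i => 4 * n + i) 0

/-- A representative of the orbit of a word under `renameLetters` and reversal. -/
def canonical (w : List ℕ) : List ℕ :=
  let u := renameLetters w
  let v := renameLetters w.reverse
  bif code u ≤ code v then u else v

lemma symmEval_canonical (a b c d : R) (w : List ℕ) :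
    symmEval a b c d (canonical w) = symmEval a b c d w := by
  simp only [canonical, Bool.cond_eq_ite, apply_ite (symmEval a b c d), symmEval_renameLetters,
    symmEval_reverse, ite_self]

/-- Add `k` times the word `w`, with code `n`, to a formal combination of words. -/
def addWord (k : ℤ) (n : ℕ) (w : List ℕ) : List (ℤ × ℕ × List ℕ) → List (ℤ × ℕ × List ℕ)
  | [] => [(k, n, w)]
  | (l, m, v) :: s => bif n == m && w == v then (k + l, m, v) :: s else (l, m, v) :: addWord k n w s

/-- Add `k` times the canonical form of each word of a list to a formal combination of words. -/
def addWords (k : ℤ) (L : List (List ℕ)) (s : List (ℤ × ℕ × List ℕ)) : List (ℤ × ℕ × List ℕ) :=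
  L.foldl (fun s w => let v := canonical w; addWord k (code v) v s) s

/-- The value of a formal combination of words under a map to an additive group. -/
def evalComb {A : Type*} [AddCommGroup A] (φ : List ℕ → A) (s : List (ℤ × ℕ × List ℕ)) : A :=
  (s.map fun t => t.1 • φ t.2.2).sum

lemma evalComb_addWord {A : Type*} [AddCommGroup A] (φ : List ℕ → A) (k : ℤ) (n : ℕ) (w : List ℕ)
    (s : List (ℤ × ℕ × List ℕ)) : evalComb φ (addWord k n w s) = k • φ w + evalComb φ s := by
  induction s with
  | nil => simp [addWord, evalComb]
  | cons t s ih =>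
    obtain ⟨l, m, v⟩ := t
    simp only [evalComb] at ih
    by_cases h : (n == m && w == v) = true
    · have hw : φ w = φ v := by
        rw [show w = v by simp_all]
      simp only [addWord, h, evalComb, cond_true, List.map_cons, List.sum_cons, hw, add_smul,
        add_assoc]
    · simp only [addWord, h, evalComb, cond_false, List.map_cons, List.sum_cons, ih]
      abel

lemma evalComb_addWords (a b c d : R) (k : ℤ) (L : List (List ℕ)) (s : List (ℤ × ℕ × List ℕ)) :
    evalComb (symmEval a b c d) (addWords k L s) =
      k • (L.map (symmEval a b c d)).sum + evalComb (symmEval a b c d) s := by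
  induction L generalizing s with
  | nil => simp [addWords]
  | cons w L ih =>
    simp only [addWords] at ih
    simp only [addWords, List.foldl_cons, ih, evalComb_addWord, symmEval_canonical, List.map_cons,
      List.sum_cons, smul_add]
    abel

/-- Coefficients of an expression of a multiple of the orbit sum of `00112233` through
`symmWords`. -/
def certificate : List (ℤ × List ℕ × List ℕ × List ℕ × List ℕ × List ℕ) :=
  [
    (48, [2], [0], [2,3], [0,1,1], [3]),
    (-96, [1], [0], [0], [1,2], [2,3,3]),
    (-96, [3,1,2,3], [0], [0], [1,2], []),
    (24, [1], [0], [0], [3,2,2], [1,3]),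
    (-48, [], [0], [0], [2,3], [1,2,3,1]),
    (144, [1,1,2], [0], [0], [2,3], [3]),
    (-192, [1,2,1,3], [0], [0], [2,3], []),
    (48, [2,1], [0], [0], [2,3], [1,3]),
    (-96, [], [0], [0], [1], [1,2,3,3,2]),
    (-96, [], [0], [0], [1], [2,1,3,3,2]),
    (-696, [], [0], [0], [1], [2,2,1,3,3]),
    (-96, [1,2], [0], [0], [1], [3,2,3]),
    (-96, [1,2], [0], [0], [1], [2,3,3]),
    (192, [1,2,2,3], [0], [0], [1], [3]),
    (48, [1,2,3], [0], [0], [1], [2,3]),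
    (48, [1,2,3], [0], [0], [1], [3,2]),
    (-48, [1,2,3,3], [0], [0], [1], [2]),
    (-12, [1,2,3,3,2], [0], [0], [1], []),
    (96, [2], [0], [0], [1], [2,1,3,3]),
    (624, [2,1,2], [0], [0], [1], [3,3]),
    (-96, [2,1,3,2], [0], [0], [1], [3]),
    (96, [2,1,3,3,2], [0], [0], [1], []),
    (432, [2,2], [0], [0], [1], [1,3,3]),
    (392, [], [0], [0], [1,1], [2,2,3,3]),
    (-138, [2], [0], [0], [1,1], [2,3,3]),
    (6, [2], [0], [0], [1,1], [3,3,2]),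
    (-90, [2], [0], [0], [1,1], [3,2,3]),
    (-84, [2,2], [0], [0], [1,1], [3,3]),
    (696, [], [0], [0], [2], [2,1,1,3,3]),
    (-264, [], [0], [0], [2], [1,3,1,3,2]),
    (888, [], [0], [0], [2], [1,1,2,3,3]),
    (-48, [], [0], [0], [2], [3,1,2,1,3]),
    (-144, [], [0], [0], [2], [1,3,2,1,3]),
    (-192, [], [0], [0], [2], [1,2,3,3,1]),
    (-96, [], [0], [0], [2], [1,3,2,3,1]),
    (96, [], [0], [0], [2], [1,2,1,3,3]),
    (216, [1], [0], [0], [2], [2,3,3,1]),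
    (264, [1], [0], [0], [2], [2,3,1,3]),
    (-96, [1], [0], [0], [2], [1,3,3,2]),
    (-96, [1], [0], [0], [2], [3,3,1,2]),
    (192, [1,1], [0], [0], [2], [3,3,2]),
    (-96, [1,1], [0], [0], [2], [2,3,3]),
    (-96, [1,1,2], [0], [0], [2], [3,3]),
    (48, [1,1,2,3], [0], [0], [2], [3]),
    (168, [1,1,2,3,3], [0], [0], [2], []),
    (264, [1,1,3], [0], [0], [2], [2,3]),
    (-288, [1,1,3,2,3], [0], [0], [2], []),
    (144, [1,1,3,3], [0], [0], [2], [2]),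
    (-264, [1,2], [0], [0], [2], [3,3,1]),
    (-408, [1,2], [0], [0], [2], [3,1,3]),
    (-240, [1,2,1], [0], [0], [2], [3,3]),
    (96, [1,2,1,3], [0], [0], [2], [3]),
    (192, [1,2,1,3,3], [0], [0], [2], []),
    (48, [1,2,3,1], [0], [0], [2], [3]),
    (384, [1,2,3,1,3], [0], [0], [2], []),
    (-48, [1,3], [0], [0], [2], [3,1,2]),
    (144, [1,3], [0], [0], [2], [2,1,3]),
    (360, [1,3,1,2], [0], [0], [2], [3]),
    (144, [1,3,2], [0], [0], [2], [1,3]),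
    (-48, [1,3,2,1], [0], [0], [2], [3]),
    (192, [1,3,2,1,3], [0], [0], [2], []),
    (-240, [1,3,3], [0], [0], [2], [1,2]),
    (-120, [2], [0], [0], [2], [1,1,3,3]),
    (144, [2], [0], [0], [2], [3,1,1,3]),
    (-192, [2,1], [0], [0], [2], [1,3,3]),
    (-192, [2,1], [0], [0], [2], [3,1,3]),
    (48, [2,1,1,3], [0], [0], [2], [3]),
    (264, [2,1,1,3,3], [0], [0], [2], []),
    (-48, [2,3], [0], [0], [2], [1,1,3]),
    (-264, [2,3,1,1,3], [0], [0], [2], []),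
    (264, [3,1,1,2], [0], [0], [2], [3]),
    (96, [3,1,1,2,3], [0], [0], [2], []),
    (48, [], [0], [0], [2,2], [1,3,1,3]),
    (72, [1], [0], [0], [2,2], [1,3,3]),
    (-216, [1,1,3,3], [0], [0], [2,2], []),
    (-72, [1,3,1,3], [0], [0], [2,2], []),
    (-152, [], [0], [1], [0,1], [2,2,3,3]),
    (96, [2,0], [0], [1], [2,3], [1,3]),
    (96, [], [0], [1], [2], [0,2,3,3,1]),
    (192, [0], [0], [1], [2], [3,2,1,3]),
    (192, [0], [0], [1], [2], [1,2,3,3]),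
    (96, [0,3], [0], [1], [2], [3,1,2]),
    (96, [0,3], [0], [1], [2], [2,1,3]),
    (-192, [0,3,3], [0], [1], [2], [1,2]),
    (-288, [2], [0], [1], [2], [0,1,3,3]),
    (-96, [3,0,1,2,3], [0], [1], [2], []),
    (-144, [0,1], [0], [1], [2,2], [3,3]),
    (96, [0,3], [0], [1], [2,2], [1,3]),
    (-276, [], [0], [1,1], [2,2], [3,0,3]),
    (-96, [1,3], [0], [2], [0,2], [1,3]),
    (-96, [1,2], [0], [2], [1,3], [0,3]),
    (-48, [0], [0], [2], [1,1], [3,3,2]),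
    (-48, [0,2,3], [0], [2], [1,1], [3]),
    (-96, [0,3,2], [0], [2], [1,1], [3]),
    (96, [2,0], [0], [2], [1,1], [3,3]),
    (96, [0,1], [0], [2,2], [1,3], [3]),
    (150, [], [0], [2,2], [3,3], [1,0,1]),
    (108, [], [0], [2,2], [3,3], [0,1,1]),
    (48, [0], [0], [2,2], [3,3], [1,1]),
    (-36, [], [0,0], [1,2,2], [1,3,3], []),
    (-36, [], [0,0], [1,1], [3,2,2], [3]),
    (-48, [2], [0,0], [1,1], [2,3], [3]),
    (33, [], [0,0], [1,1], [2,2], [3,3]),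
    (3, [3], [0,0], [1,1], [2,2], [3]),
    (72, [1], [0,0], [2,2], [1,3], [3])
  ]

/-- The formal combination of words described by a list of coefficients. -/
def expand (C : List (ℤ × List ℕ × List ℕ × List ℕ × List ℕ × List ℕ)) :
    List (ℤ × ℕ × List ℕ) :=
  C.foldr (fun t s => addWords t.1
    (symmWords t.2.1 t.2.2.1 t.2.2.2.1 t.2.2.2.2.1 t.2.2.2.2.2) s) []

lemma evalComb_expand {J : Set R} (hJ : IsCubeZeroJordan J) {a b c d : R} (ha : a ∈ J)
    (hb : b ∈ J) (hc : c ∈ J) (hd : d ∈ J)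
    (C : List (ℤ × List ℕ × List ℕ × List ℕ × List ℕ × List ℕ)) :
    evalComb (symmEval a b c d) (expand C) = 0 := by
  induction C with
  | nil => simp [expand, evalComb]
  | cons t C ih =>
    simp only [expand] at ih
    simp only [expand, List.foldr_cons, evalComb_addWords, ih,
      sum_symmEval_symmWords hJ ha hb hc hd, smul_zero, add_zero]

lemma expand_certificate :
    (expand certificate).filter (fun t => t.1 != 0) = [(3456, 1455, [0, 0, 1, 1, 2, 2, 3, 3])] := by
  decide +kernel

lemma evalComb_filter {A : Type*} [AddCommGroup A] (φ : List ℕ → A) (s : List (ℤ × ℕ × List ℕ)) :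
    evalComb φ (s.filter fun t => t.1 != 0) = evalComb φ s := by
  induction s with
  | nil => rfl
  | cons t s ih =>
    simp only [evalComb] at ih
    by_cases h : t.1 = 0 <;> simp [evalComb, h, ih]

/-- In terms of the anticommutator `∘`, the product `(a² ∘ b²) ∘ (c² ∘ d²)` is annihilated by an
integer whose only prime factors are `2` and `3`. -/
lemma IsCubeZeroJordan.smul_anticomm_sq {J : Set R} (hJ : IsCubeZeroJordan J) {a b c d : R}
    (ha : a ∈ J) (hb : b ∈ J) (hc : c ∈ J) (hd : d ∈ J) :
    (2 ^ 8 * 3 ^ 3 : ℤ) •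
      ((a * a * (b * b) + b * b * (a * a)) * (c * c * (d * d) + d * d * (c * c)) +
        (c * c * (d * d) + d * d * (c * c)) * (a * a * (b * b) + b * b * (a * a))) = 0 := by
  have h := evalComb_expand hJ ha hb hc hd certificate
  rw [← evalComb_filter, expand_certificate] at h
  rw [← h, show (2 ^ 8 * 3 ^ 3 : ℤ) = 3456 * 2 by norm_num, mul_smul]
  simp only [evalComb, List.map_cons, List.map_nil, List.sum_cons, List.sum_nil, add_zero]
  congr 1
  simp only [symmEval, evalWordRev, evalWord, letters, List.reverse_cons, List.reverse_nil,
    List.nil_append, List.cons_append, List.map_cons, List.map_nil, List.prod_cons, List.prod_nil,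
    mul_one, two_smul, mul_add, add_mul, mul_assoc]
  abel

end Words

section Algebra

variable {K N : Type*} [Field K] [NonUnitalNonAssocCommRing N] [Module K N]

lemma eq_zero_of_add_self {M : Type*} [AddCommGroup M] [Module K M] (h2 : (2 : K) ≠ 0)
    {x : M} (h : x + x = 0) : x = 0 := by
  rw [← two_smul K] at h
  exact (smul_eq_zero_iff_right h2).mp h

/-- The full linearization of the identity `x³ = 0`. -/
lemma jacobi (h2 : (2 : K) ≠ 0) (hcube : ∀ x : N, (x * x) * x = 0) (x y z : N) :
    (x * y) * z + (y * z) * x + (z * x) * y = 0 := by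
  apply eq_zero_of_add_self h2
  have h := hcube (x + y + z)
  have hxy := hcube (x + y)
  have hyz := hcube (y + z)
  have hxz := hcube (x + z)
  have hx := hcube x
  have hy := hcube y
  have hz := hcube z
  have key : (x * y) * z + (y * z) * x + (z * x) * y + ((x * y) * z + (y * z) * x + (z * x) * y) =
      ((x + y + z) * (x + y + z)) * (x + y + z) - ((x + y) * (x + y)) * (x + y) -
      ((y + z) * (y + z)) * (y + z) - ((x + z) * (x + z)) * (x + z) + (x * x) * x + (y * y) * y +
      (z * z) * z := by
    simp only [mul_add, add_mul, mul_comm y x, mul_comm z x, mul_comm z y]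
    abel
  rw [key, h, hxy, hyz, hxz, hx, hy, hz]
  simp

/-- Multiplication operators are antiderivations. -/
lemma mul_mul_eq (h2 : (2 : K) ≠ 0) (hcube : ∀ x : N, (x * x) * x = 0) (x y z : N) :
    x * (y * z) = -((x * y) * z) - y * (x * z) := by
  have h := jacobi h2 hcube x y z
  rw [mul_comm (y * z), mul_comm z x, mul_comm (x * z)] at h
  rw [eq_sub_iff_add_eq, eq_neg_iff_add_eq_zero, ← h]
  abel

/-- The right-nested operator word `l₁ * (l₂ * (⋯ * (lₖ * p)))`. -/
def leftWord (l : List N) (p : N) : N := l.foldr (· * ·) p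

lemma leftWord_mem {I P : Submodule K N} (hP : ∀ x ∈ I, ∀ y ∈ P, x * y ∈ P) {l : List N}
    (hl : ∀ x ∈ l, x ∈ I) {p : N} (hp : p ∈ P) : leftWord l p ∈ P := by
  induction l with
  | nil => exact hp
  | cons a l ih =>
    exact hP _ (hl a (by simp)) _ (ih fun x hx => hl x (by simp [hx]))

variable [SMulCommClass K N N]

lemma mulLeft_mul (h2 : (2 : K) ≠ 0) (hcube : ∀ x : N, (x * x) * x = 0) (x y : N) :
    LinearMap.mulLeft K (x * y) = -(LinearMap.mulLeft K x * LinearMap.mulLeft K y +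
      LinearMap.mulLeft K y * LinearMap.mulLeft K x) := by
  ext z
  have h := mul_mul_eq h2 hcube x y z
  simp only [LinearMap.mulLeft_apply, LinearMap.neg_apply, LinearMap.add_apply,
    Module.End.mul_apply, h]
  abel

lemma isCubeZeroJordan_range_mulLeft (h2 : (2 : K) ≠ 0) (hcube : ∀ x : N, (x * x) * x = 0) :
    IsCubeZeroJordan (Set.range fun x : N => LinearMap.mulLeft K x) where
  zero_mem := ⟨0, by ext; simp⟩
  anticomm_mem := by
    rintro _ ⟨x, rfl⟩ _ ⟨y, rfl⟩
    refine ⟨-(x * y), ?_⟩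
    have h := mulLeft_mul h2 hcube x y
    rw [eq_neg_iff_add_eq_zero] at h
    ext z
    have hz := LinearMap.congr_fun h z
    simp only [LinearMap.mulLeft_apply, LinearMap.add_apply, LinearMap.zero_apply] at hz ⊢
    rw [neg_mul, neg_eq_iff_add_eq_zero]
    exact hz
  symm_eq_zero := by
    rintro _ ⟨x, rfl⟩ _ ⟨y, rfl⟩ _ ⟨z, rfl⟩
    apply eq_zero_of_add_self h2
    have h : LinearMap.mulLeft K ((x * y) * z) + LinearMap.mulLeft K ((y * z) * x) +
        LinearMap.mulLeft K ((z * x) * y) = 0 := by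
      ext w
      simpa [add_mul] using congrArg (· * w) (jacobi h2 hcube x y z)
    simp only [mulLeft_mul h2 hcube] at h
    rw [← h]
    noncomm_ring

/-- Writing `D₀ = N` and `Dₖ₊₁ = Dₖ²`, this says `D₃ * N = 0`, as `N²` is spanned by squares. -/
lemma sq_mul_sq_mul_sq_mul_sq_mul (h2 : (2 : K) ≠ 0) (h3 : (3 : K) ≠ 0)
    (hcube : ∀ x : N, (x * x) * x = 0) (a b c d x : N) :
    (((a * a) * (b * b)) * ((c * c) * (d * d))) * x = 0 := by
  have h := (isCubeZeroJordan_range_mulLeft h2 hcube).smul_anticomm_sq (Set.mem_range_self a)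
    (Set.mem_range_self b) (Set.mem_range_self c) (Set.mem_range_self d)
  have h6 : ((2 ^ 8 * 3 ^ 3 : ℤ) : K) ≠ 0 := by
    simp only [Int.cast_mul, Int.cast_pow, Int.cast_ofNat]
    exact mul_ne_zero (pow_ne_zero _ h2) (pow_ne_zero _ h3)
  rw [← Int.cast_smul_eq_zsmul K, smul_eq_zero_iff_right h6] at h
  have key : LinearMap.mulLeft K (((a * a) * (b * b)) * ((c * c) * (d * d))) = 0 := by
    rw [← smul_zero (-16 : ℤ), ← h]
    simp only [mulLeft_mul h2 hcube]
    noncomm_ring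
  exact LinearMap.congr_fun key x

variable [IsScalarTower K N N]

lemma mul_mem_subMul {P Q : Submodule K N} {x y : N} (hx : x ∈ P) (hy : y ∈ Q) :
    x * y ∈ subMul P Q :=
  Submodule.apply_mem_map₂ _ hx hy

lemma subMul_le {P Q T : Submodule K N} : subMul P Q ≤ T ↔ ∀ x ∈ P, ∀ y ∈ Q, x * y ∈ T :=
  Submodule.map₂_le

lemma subMul_mono {P P' Q Q' : Submodule K N} (hP : P ≤ P') (hQ : Q ≤ Q') :
    subMul P Q ≤ subMul P' Q' :=
  Submodule.map₂_le_map₂ hP hQ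

lemma subMul_comm (P Q : Submodule K N) : subMul P Q = subMul Q P := by
  apply le_antisymm <;> rw [subMul_le] <;> intro x hx y hy <;> rw [mul_comm] <;>
    exact mul_mem_subMul hy hx

lemma subMul_sup (P Q T : Submodule K N) : subMul P (Q ⊔ T) = subMul P Q ⊔ subMul P T :=
  Submodule.map₂_sup_right _ _ _ _

lemma sup_subMul (P Q T : Submodule K N) : subMul (P ⊔ Q) T = subMul P T ⊔ subMul Q T :=
  Submodule.map₂_sup_left _ _ _ _

lemma subMul_top_top_le_span_sq (h2 : (2 : K) ≠ 0) :
    subMul (⊤ : Submodule K N) ⊤ ≤ Submodule.span K (Set.range fun x : N => x * x) := by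
  rw [subMul_le]
  intro x _ y _
  have h : (2 : K) • (x * y) = (x + y) * (x + y) - x * x - y * y := by
    rw [two_smul, add_mul, mul_add, mul_add, mul_comm y x]
    abel
  rw [← Submodule.smul_mem_iff _ h2, h]
  exact sub_mem (sub_mem (Submodule.subset_span ⟨_, rfl⟩) (Submodule.subset_span ⟨_, rfl⟩))
    (Submodule.subset_span ⟨_, rfl⟩)

/-- The derived series of an algebra. -/
def derived (K N : Type*) [Field K] [NonUnitalNonAssocCommRing N] [Module K N]
    [SMulCommClass K N N] [IsScalarTower K N N] : ℕ → Submodule K N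
  | 0 => ⊤
  | k + 1 => subMul (derived K N k) (derived K N k)

lemma derived_four (h2 : (2 : K) ≠ 0) (h3 : (3 : K) ≠ 0)
    (hcube : ∀ x : N, (x * x) * x = 0) : derived K N 4 = ⊥ := by
  let S := Set.range fun x : N => x * x
  have hD1 : derived K N 1 ≤ Submodule.span K S := subMul_top_top_le_span_sq h2
  have hD3 : derived K N 3 ≤ Submodule.span K
      (Set.image2 (· * ·) (Set.image2 (· * ·) S S) (Set.image2 (· * ·) S S)) := by
    have hD2 : derived K N 2 ≤ Submodule.span K (Set.image2 (· * ·) S S) :=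
      (subMul_mono hD1 hD1).trans (Submodule.map₂_span_span _ _ _ _).le
    exact (subMul_mono hD2 hD2).trans (Submodule.map₂_span_span _ _ _ _).le
  rw [eq_bot_iff]
  refine subMul_le.mpr fun x hx y _ => ?_
  have hker : Submodule.span K
      (Set.image2 (· * ·) (Set.image2 (· * ·) S S) (Set.image2 (· * ·) S S)) ≤
      LinearMap.ker (LinearMap.mulRight K y) := by
    rw [Submodule.span_le]
    rintro _ ⟨_, ⟨_, ⟨a, rfl⟩, _, ⟨b, rfl⟩, rfl⟩, _, ⟨_, ⟨c, rfl⟩, _, ⟨d, rfl⟩, rfl⟩, rfl⟩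
    exact sq_mul_sq_mul_sq_mul_sq_mul h2 h3 hcube a b c d y
  exact hker (hD3 hx)

section Step

variable {I : Submodule K N}

lemma mul_mem_sq (hI : subMul I I ≤ I) {x y : N} (hx : x ∈ I) (hy : y ∈ subMul I I) :
    x * y ∈ subMul I I :=
  mul_mem_subMul hx (hI hy)

lemma mul_mem_sq_sq (h2 : (2 : K) ≠ 0) (hcube : ∀ x : N, (x * x) * x = 0) (hI : subMul I I ≤ I)
    {x y : N} (hx : x ∈ I) (hy : y ∈ subMul (subMul I I) (subMul I I)) :
    x * y ∈ subMul (subMul I I) (subMul I I) := by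
  have h : subMul (subMul I I) (subMul I I) ≤
      (subMul (subMul I I) (subMul I I)).comap (LinearMap.mulLeft K x) := by
    refine subMul_le.mpr fun p hp q hq => ?_
    rw [Submodule.mem_comap, LinearMap.mulLeft_apply, mul_mul_eq h2 hcube]
    exact sub_mem (neg_mem (mul_mem_subMul (mul_mem_sq hI hx hp) hq))
      (mul_mem_subMul hp (mul_mem_sq hI hx hq))
  exact h hy

lemma mul_leftWord_mem_of_mem (h2 : (2 : K) ≠ 0) (hcube : ∀ x : N, (x * x) * x = 0)
    (hI : subMul I I ≤ I) {l : List N} (hl : ∀ x ∈ l, x ∈ I) {a p : N} (ha : a ∈ l)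
    (hp : p ∈ subMul I I) : a * leftWord l p ∈ subMul (subMul I I) (subMul I I) := by
  induction l with
  | nil => simp at ha
  | cons b l ih =>
    have hl' : ∀ x ∈ l, x ∈ I := fun x hx => hl x (by simp [hx])
    have hb : b ∈ I := hl b (by simp)
    have hw : leftWord l p ∈ subMul I I :=
      leftWord_mem (fun x hx y hy => mul_mem_sq hI hx hy) hl' hp
    change a * (b * leftWord l p) ∈ _
    rcases List.mem_cons.mp ha with rfl | hal
    · have h := mul_mul_eq h2 hcube a a (leftWord l p)
      rw [← Submodule.smul_mem_iff _ h2, two_smul]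
      nth_rewrite 1 [h]
      rw [sub_add_cancel]
      exact neg_mem (mul_mem_subMul (mul_mem_subMul hb hb) hw)
    · rw [mul_mul_eq h2 hcube]
      exact sub_mem (neg_mem (mul_mem_subMul (mul_mem_subMul (hl' a hal) hb) hw))
        (mul_mem_sq_sq h2 hcube hI hb (ih hl' hal))

lemma leftWord_mem_of_not_nodup (h2 : (2 : K) ≠ 0) (hcube : ∀ x : N, (x * x) * x = 0)
    (hI : subMul I I ≤ I) {l : List N} (hl : ∀ x ∈ l, x ∈ I) (hd : ¬ l.Nodup) {p : N}
    (hp : p ∈ subMul I I) : leftWord l p ∈ subMul (subMul I I) (subMul I I) := by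
  induction l with
  | nil => simp at hd
  | cons a l ih =>
    have hl' : ∀ x ∈ l, x ∈ I := fun x hx => hl x (by simp [hx])
    by_cases ha : a ∈ l
    · exact mul_leftWord_mem_of_mem h2 hcube hI hl' ha hp
    · exact mul_mem_sq_sq h2 hcube hI (hl a (by simp))
        (ih hl' fun h => hd (List.nodup_cons.mpr ⟨ha, h⟩))

/-- The `k`-fold product `F * (F * (⋯ * (F * P)))`. -/
def iterMul (F P : Submodule K N) : ℕ → Submodule K N
  | 0 => P
  | k + 1 => subMul F (iterMul F P k)

lemma iterMul_span_le (s : Set N) (P : Submodule K N) (k : ℕ) :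
    iterMul (Submodule.span K s) P k ≤
      Submodule.span K {x | ∃ l : List N, l.length = k ∧ (∀ y ∈ l, y ∈ s) ∧
        ∃ p ∈ P, x = leftWord l p} := by
  induction k with
  | zero => exact fun p hp => Submodule.subset_span ⟨[], rfl, by simp, p, hp, rfl⟩
  | succ k ih =>
    refine (subMul_mono le_rfl ih).trans ((Submodule.map₂_span_span _ _ _ _).le.trans ?_)
    refine Submodule.span_mono ?_
    rintro _ ⟨a, ha, _, ⟨l, hl, hls, p, hp, rfl⟩, rfl⟩
    exact ⟨a :: l, by simp [hl], by simpa [ha] using hls, p, hp, rfl⟩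

lemma exists_iterMul_le (h2 : (2 : K) ≠ 0) (hcube : ∀ x : N, (x * x) * x = 0)
    (hI : subMul I I ≤ I) {F : Submodule K N} (hF : F.FG) (hFI : F ≤ I) :
    ∃ k, iterMul F (subMul I I) k ≤ subMul (subMul I I) (subMul I I) := by
  classical
  obtain ⟨s, rfl⟩ := hF
  refine ⟨s.card + 1, (iterMul_span_le _ _ _).trans (Submodule.span_le.mpr ?_)⟩
  rintro _ ⟨l, hl, hls, p, hp, rfl⟩
  refine leftWord_mem_of_not_nodup h2 hcube hI
    (fun x hx => hFI (Submodule.subset_span (hls x hx))) (fun hd => ?_) hp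
  have hle : l.toFinset.card ≤ s.card :=
    Finset.card_le_card fun x hx => hls x (List.mem_toFinset.mp hx)
  rw [List.toFinset_card_of_nodup hd] at hle
  omega

/-- If `I / I²` is finite-dimensional, then so is `I² / (I²)²`. -/
lemma exists_fg_sup_sq_sq (h2 : (2 : K) ≠ 0) (hcube : ∀ x : N, (x * x) * x = 0)
    (hI : subMul I I ≤ I) {F : Submodule K N} (hF : F.FG) (hFI : F ≤ I)
    (hle : I ≤ F ⊔ subMul I I) :
    ∃ G : Submodule K N, G.FG ∧ G ≤ subMul I I ∧
      subMul I I ≤ G ⊔ subMul (subMul I I) (subMul I I) := by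
  have hstep : subMul I I ≤ subMul F F ⊔ subMul F (subMul I I) ⊔
      subMul (subMul I I) (subMul I I) := by
    refine (subMul_mono hle hle).trans ?_
    rw [subMul_sup, sup_subMul, sup_subMul, subMul_comm (subMul I I) F]
    simp only [sup_le_iff, le_sup_right, and_true]
    refine ⟨⟨le_sup_left.trans le_sup_left, ?_⟩, ?_⟩ <;>
      exact le_sup_right.trans le_sup_left
  have hFQ : subMul F (subMul (subMul I I) (subMul I I)) ≤ subMul (subMul I I) (subMul I I) :=
    subMul_le.mpr fun x hx y hy => mul_mem_sq_sq h2 hcube hI (hFI hx) hy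
  have hiter : ∀ k, ∃ G : Submodule K N, G.FG ∧ G ≤ subMul I I ∧
      subMul I I ≤ G ⊔ iterMul F (subMul I I) k ⊔ subMul (subMul I I) (subMul I I) := by
    intro k
    induction k with
    | zero => exact ⟨⊥, Submodule.fg_bot, bot_le, le_sup_right.trans le_sup_left⟩
    | succ k ih =>
      obtain ⟨G, hG, hGI, hGle⟩ := ih
      refine ⟨subMul F F ⊔ subMul F G, (hF.map₂ _ hF).sup (hF.map₂ _ hG),
        sup_le (subMul_mono hFI hFI) (subMul_mono hFI (hGI.trans hI)), hstep.trans ?_⟩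
      refine sup_le (sup_le (le_sup_left.trans (le_sup_left.trans le_sup_left)) ?_) le_sup_right
      refine (subMul_mono le_rfl hGle).trans ?_
      rw [subMul_sup, subMul_sup]
      exact sup_le_sup (sup_le_sup le_sup_right le_rfl) hFQ
  obtain ⟨k, hk⟩ := exists_iterMul_le h2 hcube hI hF hFI
  obtain ⟨G, hG, hGI, hGle⟩ := hiter k
  exact ⟨G, hG, hGI, hGle.trans (sup_le (sup_le le_sup_left (hk.trans le_sup_right)) le_sup_right)⟩

end Step

lemma derived_succ_le (k : ℕ) : derived K N (k + 1) ≤ derived K N k := by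
  induction k with
  | zero => exact le_top
  | succ k ih => exact subMul_mono ih ih

lemma exists_fg_derived_le_sup (h2 : (2 : K) ≠ 0) (hcube : ∀ x : N, (x * x) * x = 0)
    (hfd : FiniteDimensional K (N ⧸ (subMul (⊤ : Submodule K N) ⊤))) (k : ℕ) :
    ∃ F : Submodule K N, F.FG ∧ F ≤ derived K N k ∧ derived K N k ≤ F ⊔ derived K N (k + 1) := by
  induction k with
  | zero =>
    obtain ⟨F, hF⟩ := Submodule.exists_isCompl (subMul (⊤ : Submodule K N) ⊤)
    have : FiniteDimensional K F := (Submodule.quotientEquivOfIsCompl _ _ hF).finiteDimensional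
    exact ⟨F, Submodule.fg_iff_finiteDimensional F |>.mpr this, le_top, hF.symm.sup_eq_top.ge⟩
  | succ k ih =>
    obtain ⟨F, hF, hFI, hle⟩ := ih
    exact exists_fg_sup_sq_sq h2 hcube (derived_succ_le k) hF hFI hle

lemma exists_fg_top_le_sup_derived (h2 : (2 : K) ≠ 0) (hcube : ∀ x : N, (x * x) * x = 0)
    (hfd : FiniteDimensional K (N ⧸ (subMul (⊤ : Submodule K N) ⊤))) (k : ℕ) :
    ∃ F : Submodule K N, F.FG ∧ ⊤ ≤ F ⊔ derived K N k := by
  induction k with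
  | zero => exact ⟨⊥, Submodule.fg_bot, le_sup_right⟩
  | succ k ih =>
    obtain ⟨F, hF, hle⟩ := ih
    obtain ⟨G, hG, -, hGle⟩ := exists_fg_derived_le_sup h2 hcube hfd k
    refine ⟨F ⊔ G, hF.sup hG, hle.trans ?_⟩
    rw [sup_assoc]
    exact sup_le_sup le_rfl hGle

end Algebra
end CubeZero

/-- Let `K` be a field of characteristic `≠ 2, 3` and let `N` be a commutative
(not necessarily associative) `K`-algebra satisfying the identity `x³ = 0` (where `x³ = x²·x`)
and such that the quotient `N/N²` is finite-dimensional over `K`, where `N²` is the linear span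
of all products of two elements of `N`.  Then `N` is finite-dimensional over `K`. -/
theorem cube_zero_finiteDimensional_of_quotient_sq_finiteDimensional {K N : Type*} [Field K]
    [NonUnitalNonAssocCommRing N] [Module K N] [SMulCommClass K N N] [IsScalarTower K N N]
    (h2 : (2 : K) ≠ 0) (h3 : (3 : K) ≠ 0)
    (hcube : ∀ x : N, (x * x) * x = 0)
    -- `N/N²` is finite-dimensional
    (hfd : FiniteDimensional K (N ⧸ (subMul (⊤ : Submodule K N) ⊤))) :
    FiniteDimensional K N := by
  obtain ⟨F, hF, hle⟩ := CubeZero.exists_fg_top_le_sup_derived h2 hcube hfd 4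
  rw [CubeZero.derived_four h2 h3 hcube, sup_bot_eq, top_le_iff] at hle
  exact ⟨hle ▸ hF⟩
end
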